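/- Let F ∈ R^{l×l} with d_l(F) = det F associated to x_1^{p} x_2^{q} for positive integers p, q. If J_i(F) = R for i = 1,2,...,l, then F is equivalent to its Smith normal form D = diag(x_1^{r_1}x_2^{s_1}, x_1^{r_2}x_2^{s_2},..., x_1^{r_l}x_2^{s_l}), where d_i(F) is associated to x_1^{p_i}x_2^{q_i}, p_0 = q_0 = 0, r_i = p_i − p_{i−1}, s_i = q_i − q_{i−1} for i = 1,...,l, and moreover r_1 ≤ r_2 ≤ ... ≤ r_l and s_1 ≤ s_2 ≤ ... ≤ s_l. -/

import Mathlib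

open Matrix MvPolynomial

/-- The set of `k × k` minors of a matrix: determinants of submatrices obtained by
choosing `k` rows and `k` columns. -/
def minorsSet {R : Type*} [CommRing R] {l m : ℕ} (k : ℕ)
    (F : Matrix (Fin l) (Fin m) R) : Set R :=
  { d | ∃ (ri : Fin k → Fin l) (ci : Fin k → Fin m),
      Function.Injective ri ∧ Function.Injective ci ∧ d = (F.submatrix ri ci).det }

/-- `d` is a greatest common divisor of the `k × k` minors of `F`. -/
def IsGcdMinors {R : Type*} [CommRing R] {l m : ℕ} (k : ℕ)
    (F : Matrix (Fin l) (Fin m) R) (d : R) : Prop :=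
  (∀ a ∈ minorsSet k F, d ∣ a) ∧ ∀ e : R, (∀ a ∈ minorsSet k F, e ∣ a) → e ∣ d

/-- `J_k(F) = R` : the ideal generated by the reduced `k`-th order minors
(the `k × k` minors divided by their g.c.d.) is the unit ideal. -/
def JEqTop {R : Type*} [CommRing R] {l m : ℕ} (k : ℕ)
    (F : Matrix (Fin l) (Fin m) R) : Prop :=
  ∃ d : R, IsGcdMinors k F d ∧ Ideal.span { b : R | d * b ∈ minorsSet k F } = ⊤

/-- The normal rank of a polynomial matrix: its rank over the fraction field. -/
noncomputable def normalRank {K : Type*} [Field K] {n l m : ℕ}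
    (F : Matrix (Fin l) (Fin m) (MvPolynomial (Fin n) K)) : ℕ :=
  (F.map (algebraMap (MvPolynomial (Fin n) K)
      (FractionRing (MvPolynomial (Fin n) K)))).rank

/-- Equivalence of matrices: `G = M * F * N` with `M`, `N` unimodular
(i.e. with determinant a unit, a nonzero constant). -/
def MatEquiv {R : Type*} [CommRing R] {l m : ℕ}
    (F G : Matrix (Fin l) (Fin m) R) : Prop :=
  ∃ (M : Matrix (Fin l) (Fin l) R) (N : Matrix (Fin m) (Fin m) R),
    IsUnit M.det ∧ IsUnit N.det ∧ G = M * F * N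

/-- A matrix is zero left prime (ZLP) if its maximal (row-size) order minors
generate the unit ideal. -/
def ZLP {R : Type*} [CommRing R] {l m : ℕ} (F : Matrix (Fin l) (Fin m) R) : Prop :=
  Ideal.span (minorsSet l F) = ⊤

section Nagata

/-- The Nagata substitution `X_i ↦ X_i + c X_0 ^ (N ^ i)` for `i ≠ 0`, fixing `X_0`. -/
noncomputable def nagataHom (K : Type*) [Field K] (n N : ℕ) (c : K) :
    MvPolynomial (Fin (n + 1)) K →ₐ[K] MvPolynomial (Fin (n + 1)) K :=
  aeval fun i ↦ if i = 0 then X 0 else X i + c • X 0 ^ N ^ (i : ℕ)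

theorem nagataHom_comp_neg {K : Type*} [Field K] (n N : ℕ) (c : K) :
    (nagataHom K n N c).comp (nagataHom K n N (-c)) = AlgHom.id _ _ := by
  rw [nagataHom, nagataHom, comp_aeval, ← MvPolynomial.aeval_X_left]
  ext i v
  cases i using Fin.cases <;> simp

/-- The Nagata substitution as an automorphism. -/
noncomputable def nagataEquiv (K : Type*) [Field K] (n N : ℕ) :
    MvPolynomial (Fin (n + 1)) K ≃ₐ[K] MvPolynomial (Fin (n + 1)) K :=
  AlgEquiv.ofAlgHom (nagataHom K n N 1) (nagataHom K n N (-1))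
    (nagataHom_comp_neg n N 1) (by simpa using nagataHom_comp_neg n N (-1 : K))

theorem nagataEquiv_X {K : Type*} [Field K] (n N : ℕ) (i : Fin (n + 1)) :
    finSuccEquiv K n (nagataEquiv K n N (X i)) =
      Fin.cases Polynomial.X
        (fun j : Fin n ↦ Polynomial.X ^ N ^ ((j : ℕ) + 1) + Polynomial.C (X j)) i := by
  cases i using Fin.cases with
  | zero => simp [nagataEquiv, nagataHom, finSuccEquiv_X_zero]
  | succ j => simp [nagataEquiv, nagataHom, finSuccEquiv_X_zero, finSuccEquiv_X_succ, add_comm]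

theorem finSuccEquiv_nagataEquiv_monomial {K : Type*} [Field K] {n N : ℕ} (hN : N ≠ 0)
    (v : Fin (n + 1) →₀ ℕ) {a : K} (ha : a ≠ 0) :
    (finSuccEquiv K n (nagataEquiv K n N (monomial v a))).natDegree =
        ∑ i : Fin (n + 1), N ^ (i : ℕ) * v i ∧
      (finSuccEquiv K n (nagataEquiv K n N (monomial v a))).leadingCoeff = C a := by
  have hm (i : Fin (n + 1)) :
      (finSuccEquiv K n (nagataEquiv K n N (X i))).Monic ∧
      (finSuccEquiv K n (nagataEquiv K n N (X i))).natDegree = N ^ (i : ℕ) := by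
    rw [nagataEquiv_X]
    cases i using Fin.cases with
    | zero => simp [Polynomial.monic_X]
    | succ j =>
      exact ⟨Polynomial.monic_X_pow_add_C _ (pow_ne_zero _ hN),
        by simp⟩
  have hC : finSuccEquiv K n (nagataEquiv K n N (C a)) = Polynomial.C (C a) := by
    simp [nagataEquiv, nagataHom, finSuccEquiv_apply]
  rw [monomial_eq, Finsupp.prod_fintype _ _ fun i ↦ pow_zero _]
  simp only [map_mul, map_prod, map_pow, hC]
  have hprod : (∏ i, finSuccEquiv K n (nagataEquiv K n N (X i)) ^ v i).Monic :=
    Polynomial.monic_prod_of_monic _ _ fun i _ ↦ (hm i).1.pow _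
  constructor
  · rw [Polynomial.natDegree_C_mul (by simpa using ha),
      Polynomial.natDegree_prod_of_monic _ _ fun i _ ↦ (hm i).1.pow _]
    exact Finset.sum_congr rfl fun i _ ↦ by rw [(hm i).1.natDegree_pow, (hm i).2, mul_comm]
  · rw [Polynomial.leadingCoeff_mul, hprod.leadingCoeff, Polynomial.leadingCoeff_C, mul_one]

theorem sum_pow_mul_injOn {n N : ℕ} (hN : 1 < N) {v w : Fin n → ℕ} (hv : ∀ i, v i < N)
    (hw : ∀ i, w i < N) (h : ∑ i : Fin n, N ^ (i : ℕ) * v i = ∑ i : Fin n, N ^ (i : ℕ) * w i) :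
    v = w := by
  have key (u : Fin n → ℕ) :
      Nat.ofDigits N (List.ofFn u) = ∑ i : Fin n, N ^ (i : ℕ) * u i := by
    clear hv hw h v w
    induction n with
    | zero => simp
    | succ n ih =>
      rw [List.ofFn_succ, Nat.ofDigits_cons, ih, Fin.sum_univ_succ, Finset.mul_sum]
      simp [pow_succ', mul_assoc]
  refine List.ofFn_inj.mp (Nat.ofDigits_inj_of_len_eq hN (by simp) ?_ ?_ ?_)
  · simpa [List.mem_ofFn] using hv
  · simpa [List.mem_ofFn] using hw
  · rwa [key, key]

/-- Every nonzero polynomial becomes, after a change of variables, a polynomial in one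
distinguished variable whose leading coefficient is a unit. -/
theorem exists_equiv_isUnit_leadingCoeff {K : Type*} [Field K] {n : ℕ}
    {f : MvPolynomial (Fin (n + 1)) K} (hf : f ≠ 0) :
    ∃ e : MvPolynomial (Fin (n + 1)) K ≃+* Polynomial (MvPolynomial (Fin n) K),
      IsUnit (e f).leadingCoeff := by
  set N := 2 + f.totalDegree with hN
  let e := (nagataEquiv K n N).trans (finSuccEquiv K n)
  refine ⟨e.toRingEquiv, ?_⟩
  let h : (Fin (n + 1) →₀ ℕ) → _ := fun w ↦ e (monomial w (coeff w f))
  have key (w) (hw : w ∈ f.support) := finSuccEquiv_nagataEquiv_monomial (N := N) (by omega) w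
    (mem_support_iff.mp hw)
  obtain ⟨v, hv, hmax⟩ := Finset.exists_max_image f.support (fun w ↦ (h w).natDegree)
    (support_nonempty.mpr hf)
  have hlt (w) (hw : w ∈ f.support) (i) : w i < N :=
    lt_of_le_of_lt ((monomial_le_degreeOf i hw).trans (degreeOf_le_totalDegree f i)) (by omega)
  have hne (w) (hw : w ∈ f.support) : h w ≠ 0 := by
    simpa [h] using mem_support_iff.mp hw
  have hdeg : (∑ w ∈ f.support.erase v, h w).degree < (h v).degree := by
    refine (Polynomial.degree_sum_le _ _).trans_lt
      ((Finset.sup_lt_iff (Ne.bot_lt fun x ↦ hne v hv (Polynomial.degree_eq_bot.mp x))).mpr ?_)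
    intro w hw
    obtain ⟨hwv, hw⟩ := Finset.mem_erase.mp hw
    refine Polynomial.degree_lt_degree (lt_of_le_of_ne (hmax w hw) fun hd ↦ hwv ?_)
    refine DFunLike.coe_injective (sum_pow_mul_injOn (by omega) (hlt w hw) (hlt v hv) ?_)
    exact (key w hw).1.symm.trans (hd.trans (key v hv).1)
  have hsum : e f = ∑ w ∈ f.support.erase v, h w + h v := by
    rw [Finset.sum_erase_add _ _ hv]
    conv_lhs => rw [← f.support_sum_monomial_coeff]
    rw [map_sum]
  change IsUnit (e f).leadingCoeff
  rw [hsum, Polynomial.leadingCoeff_add_of_degree_lt hdeg]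
  have : (h v).leadingCoeff = C (coeff v f) := (key v hv).2
  rw [this]
  exact (mem_support_iff.mp hv).isUnit.map C

end Nagata

section VecEquiv

/-- Two vectors are equivalent if an invertible matrix carries the first to the second. -/
def VecEquiv {ι B : Type*} [Fintype ι] [DecidableEq ι] [CommRing B] (v w : ι → B) : Prop :=
  ∃ M : Matrix ι ι B, IsUnit M.det ∧ M *ᵥ v = w

variable {ι κ B B' : Type*} [Fintype ι] [DecidableEq ι] [Fintype κ] [DecidableEq κ]
  [CommRing B] [CommRing B']

theorem VecEquiv.refl (v : ι → B) : VecEquiv v v :=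
  ⟨1, by simp, by simp⟩

theorem VecEquiv.trans {u v w : ι → B} (h : VecEquiv u v) (h' : VecEquiv v w) : VecEquiv u w := by
  obtain ⟨M, hM, rfl⟩ := h
  obtain ⟨N, hN, rfl⟩ := h'
  exact ⟨N * M, by simpa using ⟨hN, hM⟩, by simp⟩

theorem VecEquiv.symm {v w : ι → B} (h : VecEquiv v w) : VecEquiv w v := by
  obtain ⟨M, hM, rfl⟩ := h
  exact ⟨M⁻¹, M.isUnit_nonsing_inv_det hM, by simp [Matrix.nonsing_inv_mul _ hM]⟩

theorem VecEquiv.map {v w : ι → B} (h : VecEquiv v w) (f : B →+* B') :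
    VecEquiv (fun i ↦ f (v i)) (fun i ↦ f (w i)) := by
  obtain ⟨M, hM, rfl⟩ := h
  refine ⟨f.mapMatrix M, by rw [← RingHom.map_det]; exact hM.map f, ?_⟩
  ext i
  exact (RingHom.map_mulVec f M v i).symm

theorem VecEquiv.comp_equiv {v w : ι → B} (h : VecEquiv v w) (e : κ ≃ ι) :
    VecEquiv (v ∘ e) (w ∘ e) := by
  obtain ⟨M, hM, rfl⟩ := h
  refine ⟨M.submatrix e e, by simpa using hM, ?_⟩
  rw [Matrix.submatrix_mulVec_equiv]
  simp [Function.comp_assoc]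

/-- Unimodularity of a vector is invariant under equivalence. -/
theorem VecEquiv.exists_dotProduct {v w : ι → B} (h : VecEquiv v w) (hv : ∃ u, u ⬝ᵥ v = 1) :
    ∃ u, u ⬝ᵥ w = 1 := by
  obtain ⟨M, hM, rfl⟩ := h.symm
  obtain ⟨u, hu⟩ := hv
  exact ⟨u ᵥ* M, by rw [← Matrix.dotProduct_mulVec, hu]⟩

theorem vecEquiv_smul {v : ι → B} {c : B} (hc : IsUnit c) : VecEquiv v (c • v) :=
  ⟨c • 1, by simpa [Matrix.det_smul] using hc.pow _, by simp [Matrix.smul_mulVec]⟩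

theorem vecEquiv_single_of_isUnit {v : ι → B} {j : ι} (hj : IsUnit (v j)) (i : ι) :
    VecEquiv v (Pi.single i 1) := by
  have h1 : VecEquiv (Pi.single j (1 : B)) v := by
    refine ⟨(1 : Matrix ι ι B).updateCol j v, ?_, ?_⟩
    · rw [← Matrix.cramer_apply]
      simpa using hj
    · ext k
      simp
  have h2 : VecEquiv (Pi.single j (1 : B)) (Pi.single i (1 : B)) := by
    refine ⟨(Equiv.swap i j).toPEquiv.toMatrix, ?_, ?_⟩
    · rw [← Equiv.Perm.permMatrix, Matrix.det_permutation]
      exact (Units.isUnit _).map (Int.castRingHom B)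
    · ext k
      have : i = k ↔ j = Equiv.swap i j k := by
        rw [eq_comm (a := j), Equiv.swap_apply_eq_iff, Equiv.swap_apply_right, eq_comm]
      simp [PEquiv.toMatrix_apply, Pi.single_apply, eq_comm, this]
  exact h1.symm.trans h2

end VecEquiv

section Suslin

variable {A : Type*} [CommRing A]

theorem exists_det_eq_one_mul_eq {S ι : Type*} [CommRing S] [IsDomain S] [Fintype ι]
    [DecidableEq ι] {P Q : Matrix ι ι S} {γ : S} (hγ : γ ≠ 0) (hP : P.det = γ) (hQ : Q.det = γ)
    (h : ∀ i j, γ ∣ P i j - Q i j) : ∃ N : Matrix ι ι S, N.det = 1 ∧ N * Q = P := by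
  choose E hE using h
  have hPE : P = Q + γ • Matrix.of E := by
    ext i j
    simp [← hE]
  have hN : (1 + Matrix.of E * Q.adjugate) * Q = P := by
    rw [add_mul, Matrix.mul_assoc, Matrix.adjugate_mul, hQ, hPE]
    simp
  refine ⟨_, ?_, hN⟩
  have := congrArg Matrix.det hN
  rw [Matrix.det_mul, hP, hQ] at this
  exact mul_right_cancel₀ hγ (this.trans (one_mul γ).symm)

theorem comp_add_C_mul_sub_dvd (p b d : Polynomial A) (c : A) :
    Polynomial.C c ∣ p.comp (b + Polynomial.C c * d) - p.comp b := by
  have := Polynomial.sub_dvd_eval_sub (b + Polynomial.C c * d) b (p.map Polynomial.C)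
  rw [Polynomial.eval_map, Polynomial.eval_map] at this
  refine Dvd.dvd.trans ?_ this
  simp

/-- Suslin's lemma: translating the variable by a multiple of a constant in the ideal generated by
two entries does not change the equivalence class of a vector. -/
theorem vecEquiv_comp_add_C_mul [IsDomain A] {κ : Type*} [Fintype κ] [DecidableEq κ]
    (v : Fin 2 ⊕ κ → Polynomial A) {c : A} {f g : Polynomial A}
    (hc : Polynomial.C c = f * v (.inl 0) + g * v (.inl 1)) (b d : Polynomial A) :
    VecEquiv (fun i ↦ (v i).comp b) (fun i ↦ (v i).comp (b + Polynomial.C c * d)) := by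
  obtain rfl | hc0 := eq_or_ne c 0
  · simpa using VecEquiv.refl _
  set b' := b + Polynomial.C c * d with hb'
  have hcomp (q : Polynomial A) :
      (f * v (.inl 0) + g * v (.inl 1)).comp q = Polynomial.C c := by
    rw [← hc, Polynomial.C_comp]
  simp only [Polynomial.add_comp, Polynomial.mul_comp] at hcomp
  let Q (q : Polynomial A) : Matrix (Fin 2) (Fin 2) (Polynomial A) :=
    !![(v (.inl 0)).comp q, (-g).comp q; (v (.inl 1)).comp q, f.comp q]
  have hQ (q) : (Q q).det = Polynomial.C c := by
    rw [← hcomp q, Matrix.det_fin_two_of, Polynomial.neg_comp]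
    ring
  obtain ⟨N, hN, hNQ⟩ := exists_det_eq_one_mul_eq (P := Q b') (Q := Q b)
    (by simpa using hc0) (hQ _) (hQ _) (by
      intro i j
      fin_cases i <;> fin_cases j <;> exact comp_add_C_mul_sub_dvd _ _ _ _)
  choose w hw using fun k ↦ comp_add_C_mul_sub_dvd (v (.inr k)) b d c
  refine ⟨fromBlocks N 0 (Matrix.of fun k ↦ ![w k * f.comp b, w k * g.comp b]) 1, ?_, ?_⟩
  · simp [hN]
  · rw [Matrix.fromBlocks_mulVec]
    ext1 i
    obtain i | k := i
    · have := congrFun (congrFun hNQ i) 0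
      simp only [Matrix.mul_apply, Fin.sum_univ_two, Q] at this
      fin_cases i <;> simpa [Matrix.mulVec, dotProduct, Fin.sum_univ_two] using this
    · have h1 := hw k
      rw [← hb'] at h1
      have h2 := hcomp b
      simp only [Sum.elim_inr, Matrix.one_mulVec, Pi.add_apply, Function.comp, Matrix.mulVec,
        dotProduct, Fin.sum_univ_two, Matrix.of_apply, Matrix.cons_val_zero, Matrix.cons_val_one]
      linear_combination w k * h2 - h1

/-- The constants by whose multiples the variable may be translated without changing the
equivalence class of the vector. -/
def translationIdeal {ι : Type*} [Fintype ι] [DecidableEq ι] (v : ι → Polynomial A) : Ideal A where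
  carrier := {c | ∀ b d, VecEquiv (fun i ↦ (v i).comp b)
    (fun i ↦ (v i).comp (b + Polynomial.C c * d))}
  zero_mem' b d := by simpa using VecEquiv.refl _
  add_mem' {c c'} h h' b d := by
    have := (h b d).trans (h' _ d)
    rwa [add_assoc, ← add_mul, ← Polynomial.C_add] at this
  smul_mem' a c h b d := by
    have := h b (Polynomial.C a * d)
    rwa [← mul_assoc, ← Polynomial.C_mul, mul_comm c] at this

theorem translationIdeal_le_of_vecEquiv {ι : Type*} [Fintype ι] [DecidableEq ι]
    {v w : ι → Polynomial A} (h : VecEquiv v w) : translationIdeal v ≤ translationIdeal w :=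
  fun _ hc b d ↦ (h.symm.map (Polynomial.compRingHom b)).trans
    ((hc b d).trans (h.map (Polynomial.compRingHom _)))

theorem exists_isCoprime_add_mul {S : Type*} [CommRing S] [IsDomain S] [IsPrincipalIdealRing S]
    {a b c : S} (ha : a ≠ 0) (h : ∃ x y z, x * a + y * b + z * c = 1) :
    ∃ t, IsCoprime a (b + t * c) := by
  classical
  obtain ⟨x, y, z, h⟩ := h
  let s := (UniqueFactorizationMonoid.factors a).filter fun q ↦ ¬ q ∣ b
  refine ⟨s.prod, isCoprime_of_prime_dvd (fun h0 ↦ ha h0.1) ?_⟩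
  intro p hp hpa hpb
  by_cases hb : p ∣ b
  · obtain hs | hc := hp.dvd_or_dvd ((dvd_add_right hb).mp hpb)
    · obtain ⟨q, hq, hpq⟩ := hp.exists_mem_multiset_dvd hs
      obtain ⟨hqa, hqb⟩ := Multiset.mem_filter.mp hq
      have hq' := UniqueFactorizationMonoid.irreducible_of_factor q hqa
      exact (hqb ((hp.irreducible.associated_of_dvd hq' hpq).symm.dvd.trans hb)).elim
    · refine hp.not_isUnit (isUnit_of_dvd_one ?_)
      rw [← h]
      exact dvd_add (dvd_add (hpa.mul_left _) (hb.mul_left _)) (hc.mul_left _)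
  · obtain ⟨q, hq, hpq⟩ := UniqueFactorizationMonoid.exists_mem_factors_of_dvd ha hp.irreducible hpa
    refine hb ((dvd_add_left ?_).mp hpb)
    refine Dvd.dvd.mul_right (hpq.dvd.trans (Multiset.dvd_prod ?_)) _
    exact Multiset.mem_filter.mpr ⟨hq, fun h ↦ hb (hpq.dvd.trans h)⟩

end Suslin

section Monic

variable {A : Type*} [CommRing A]

theorem exists_dotProduct_map {ι B B' : Type*} [Fintype ι] [CommRing B] [CommRing B']
    {v : ι → B} (hv : ∃ u, u ⬝ᵥ v = 1) (f : B →+* B') : ∃ u, u ⬝ᵥ (fun i ↦ f (v i)) = 1 := by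
  obtain ⟨u, hu⟩ := hv
  exact ⟨fun i ↦ f (u i), by
    simpa [hu, Function.comp_def] using (RingHom.map_dotProduct f u v).symm⟩

/-- Modulo each maximal ideal, a unimodular vector with a monic entry is equivalent to one
satisfying the hypothesis of Suslin's lemma for a constant outside that ideal. -/
theorem exists_vecEquiv_C_eq {κ : Type*} [Fintype κ] [DecidableEq κ]
    {v : Fin 2 ⊕ κ → Polynomial A} (hv : ∃ u, u ⬝ᵥ v = 1) (hm : (v (.inl 0)).Monic)
    (I : Ideal A) [I.IsMaximal] :
    ∃ (w : Fin 2 ⊕ κ → Polynomial A) (c : A) (f g : Polynomial A), VecEquiv w v ∧ c ∉ I ∧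
      Polynomial.C c = f * w (.inl 0) + g * w (.inl 1) := by
  let := Ideal.Quotient.field I
  let φ := Ideal.Quotient.mk I
  let Φ := Polynomial.mapRingHom φ
  obtain ⟨u, hu⟩ := exists_dotProduct_map hv Φ
  obtain ⟨β, hβ⟩ := (inferInstance :
    (Ideal.span (Set.range fun k ↦ Φ (v (.inr k)))).IsPrincipal).principal
  have hβmem : β ∈ Ideal.span (Set.range fun k ↦ Φ (v (.inr k))) := by
    rw [hβ]; exact Submodule.mem_span_singleton_self β
  have hdvd (k) : β ∣ Φ (v (.inr k)) := by
    have : Φ (v (.inr k)) ∈ Ideal.span (Set.range fun k ↦ Φ (v (.inr k))) :=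
      Ideal.subset_span ⟨k, rfl⟩
    rw [hβ] at this
    exact Ideal.mem_span_singleton.mp this
  choose q hq using hdvd
  obtain ⟨t, ht⟩ := Ideal.mem_span_range_iff_exists_fun.mp hβmem
  obtain ⟨s, hs⟩ := exists_isCoprime_add_mul (a := Φ (v (.inl 0))) (b := Φ (v (.inl 1))) (c := β)
    (hm.map φ).ne_zero
    ⟨u (.inl 0), u (.inl 1), ∑ k, u (.inr k) * q k, by
      rw [← hu]
      simp only [dotProduct, Fintype.sum_sum_type, Fin.sum_univ_two, Finset.sum_mul]
      congr 1
      exact Finset.sum_congr rfl fun k _ ↦ by rw [hq]; ring⟩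
  have hΦ : Function.Surjective Φ := Polynomial.map_surjective φ Ideal.Quotient.mk_surjective
  choose h hh using fun k ↦ hΦ (s * t k)
  let v1 := v (.inl 1) + ∑ k, h k * v (.inr k)
  have hv1 : Φ v1 = Φ (v (.inl 1)) + s * β := by
    simp [v1, hh, ← ht, Finset.mul_sum, mul_assoc]
  rw [← hv1] at hs
  obtain ⟨f, g, -, -, hfg⟩ := Polynomial.exists_mul_add_mul_eq_C_resultant (v (.inl 0)) v1
    le_rfl (Nat.le_succ _) (.inr (Nat.succ_ne_zero _))
  refine ⟨Sum.elim ![v (.inl 0), v1] (fun k ↦ v (.inr k)),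
    (v (.inl 0)).resultant v1 (v (.inl 0)).natDegree (v1.natDegree + 1), f, g, VecEquiv.symm
    ⟨fromBlocks 1 (Matrix.of ![0, h]) 0 1, by simp, ?_⟩, ?_, ?_⟩
  · rw [Matrix.fromBlocks_mulVec]
    ext1 i
    obtain i | k := i
    · fin_cases i <;> simp [v1, dotProduct, Matrix.vecHead, Matrix.vecTail]
    · simp
  · rw [← Ideal.Quotient.eq_zero_iff_mem, ← Polynomial.resultant_map_map]
    have hd : (v1.map φ).natDegree ≤ v1.natDegree + 1 :=
      Polynomial.natDegree_map_le.trans (Nat.le_succ _)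
    obtain ⟨j, hj⟩ := Nat.exists_eq_add_of_le hd
    have hm' : ((v (.inl 0)).map φ).natDegree = (v (.inl 0)).natDegree := hm.natDegree_map φ
    have hm'' : ((v (.inl 0)).map φ).coeff (v (.inl 0)).natDegree = 1 := by
      simpa using congrArg φ hm.coeff_natDegree
    rw [hj, Polynomial.resultant_add_right_deg _ _ _ _ _ le_rfl, hm'', one_pow, one_mul, ← hm']
    exact Polynomial.resultant_ne_zero _ _ hs
  · rw [← hfg]
    simp [mul_comm]

theorem translationIdeal_eq_top [IsDomain A] {κ : Type*} [Fintype κ] [DecidableEq κ]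
    {v : Fin 2 ⊕ κ → Polynomial A} (hv : ∃ u, u ⬝ᵥ v = 1) (hm : (v (.inl 0)).Monic) :
    translationIdeal v = ⊤ := by
  by_contra hne
  obtain ⟨I, hI, hle⟩ := Ideal.exists_le_maximal _ hne
  obtain ⟨w, c, f, g, hw, hc, hcfg⟩ := exists_vecEquiv_C_eq hv hm I
  exact hc (hle (translationIdeal_le_of_vecEquiv hw fun b d ↦ vecEquiv_comp_add_C_mul w hcfg b d))

/-- A unimodular vector over `A[X]` with a monic entry is equivalent to its value at zero. -/
theorem vecEquiv_C_eval_zero [IsDomain A] {κ : Type*} [Fintype κ] [DecidableEq κ]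
    {v : Fin 2 ⊕ κ → Polynomial A} (hv : ∃ u, u ⬝ᵥ v = 1) (hm : (v (.inl 0)).Monic) :
    VecEquiv v (fun i ↦ Polynomial.C ((v i).eval 0)) := by
  have h : (1 : A) ∈ translationIdeal v := by rw [translationIdeal_eq_top hv hm]; trivial
  have := (h 0 Polynomial.X).symm
  simpa using this

/-- Every unimodular vector over `B` is equivalent to a standard basis vector. -/
def UnimodularCompletion (B : Type*) [CommRing B] : Prop :=
  ∀ (k : ℕ) (v : Fin k → B) (i : Fin k), (∃ u, u ⬝ᵥ v = 1) → VecEquiv v (Pi.single i 1)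

theorem UnimodularCompletion.of_ringEquiv {B B' : Type*} [CommRing B] [CommRing B'] (e : B ≃+* B')
    (h : UnimodularCompletion B) : UnimodularCompletion B' := by
  intro k v i hv
  have := (h k _ i (exists_dotProduct_map hv e.symm.toRingHom)).map e.toRingHom
  convert this using 1
  · ext j; simp
  · ext j
    by_cases hj : j = i
    · subst hj; simp
    · simp [hj]

/-- The unimodular vector theorem for polynomial rings over a field. -/
theorem unimodularCompletion_mvPolynomial (K : Type*) [Field K] (n : ℕ) :
    UnimodularCompletion (MvPolynomial (Fin n) K) := by
  induction n with
  | zero =>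
    intro k v i ⟨u, hu⟩
    have hne : v ≠ 0 := by rintro rfl; simp at hu
    obtain ⟨j, hj⟩ := Function.ne_iff.mp hne
    refine vecEquiv_single_of_isUnit (j := j) ?_ i
    rw [← MulEquiv.isUnit_map (isEmptyAlgEquiv K (Fin 0))]
    exact IsUnit.mk0 _ ((EmbeddingLike.map_ne_zero_iff (f := isEmptyAlgEquiv K (Fin 0))).mpr hj)
  | succ n ih =>
    intro k v i hv
    have hne : v ≠ 0 := by rintro rfl; simp at hv
    obtain ⟨j, hj⟩ := Function.ne_iff.mp hne
    obtain ⟨e, he⟩ := exists_equiv_isUnit_leadingCoeff hj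
    obtain ⟨k, rfl⟩ : ∃ k', k = k' + 1 := ⟨k - 1, by have := i.pos; omega⟩
    obtain _ | k := k
    · obtain rfl : i = j := Fin.subsingleton_one.elim _ _
      refine vecEquiv_single_of_isUnit (j := i) ?_ i
      obtain ⟨u, hu⟩ := hv
      rw [dotProduct, Fin.sum_univ_one, Fin.subsingleton_one.elim 0 i] at hu
      exact IsUnit.of_mul_eq_one_right _ hu
    obtain ⟨c, hc⟩ := he
    let w : Fin (k + 2) → Polynomial (MvPolynomial (Fin n) K) :=
      Polynomial.C (↑c⁻¹ : MvPolynomial (Fin n) K) • fun i ↦ e (v i)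
    have hcu : IsUnit (Polynomial.C (↑c⁻¹ : MvPolynomial (Fin n) K)) :=
      (c⁻¹).isUnit.map Polynomial.C
    have h1 : VecEquiv (fun i ↦ e (v i)) w := vecEquiv_smul hcu
    have hw : ∃ u, u ⬝ᵥ w = 1 := h1.exists_dotProduct (exists_dotProduct_map hv e.toRingHom)
    have hmon : (w j).Monic := by
      simp [w, Polynomial.Monic, Polynomial.leadingCoeff_mul, ← hc]
    let σ : Fin 2 ⊕ Fin k ≃ Fin (k + 2) :=
      (finSumFinEquiv.trans (finCongr (add_comm 2 k))).trans (Equiv.swap 0 j)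
    have hσ : σ (.inl 0) = j := by
      simp only [σ, Equiv.trans_apply]
      rw [show finCongr (add_comm 2 k) (finSumFinEquiv (.inl (0 : Fin 2))) = 0 from rfl]
      exact Equiv.swap_apply_left 0 j
    have h2 : VecEquiv (w ∘ σ) (fun i ↦ Polynomial.C ((w (σ i)).eval 0)) := by
      refine vecEquiv_C_eval_zero ?_ (by simpa [hσ] using hmon)
      obtain ⟨u, hu⟩ := hw
      exact ⟨u ∘ σ, by rw [← hu]; exact comp_equiv_dotProduct_comp_equiv u w σ⟩
    have h3 : VecEquiv w (fun i ↦ Polynomial.C ((w i).eval 0)) := by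
      have := h2.comp_equiv σ.symm
      simpa [Function.comp_def] using this
    have h4 := (ih (k + 2) (fun i ↦ (w i).eval 0) i
      (exists_dotProduct_map hw (Polynomial.evalRingHom 0))).map Polynomial.C
    have h5 := ((h1.trans h3).trans h4).map e.symm.toRingHom
    convert h5 using 1
    · ext j; simp
    · ext1 j
      by_cases hj : j = i
      · subst hj; simp
      · simp [hj]

end Monic

section Schanuel

variable {S P Q T : Type*} [CommRing S] [AddCommGroup P] [AddCommGroup Q] [AddCommGroup T]
  [Module S P] [Module S Q] [Module S T]

/-- Schanuel's lemma. -/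
theorem schanuel [Module.Projective S P] [Module.Projective S Q] {f : P →ₗ[S] T} {g : Q →ₗ[S] T}
    (hf : Function.Surjective f) (hg : Function.Surjective g) :
    Nonempty ((P × LinearMap.ker g) ≃ₗ[S] Q × LinearMap.ker f) := by
  obtain ⟨a, ha⟩ := Module.projective_lifting_property g f hg
  obtain ⟨c, hc⟩ := Module.projective_lifting_property f g hf
  replace ha (p) : g (a p) = f p := LinearMap.congr_fun ha p
  replace hc (q) : f (c q) = g q := LinearMap.congr_fun hc q
  let A : P × LinearMap.ker g →ₗ[S] Q :=
    a ∘ₗ LinearMap.fst _ _ _ + (LinearMap.ker g).subtype ∘ₗ LinearMap.snd _ _ _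
  let B : Q × LinearMap.ker f →ₗ[S] P :=
    c ∘ₗ LinearMap.fst _ _ _ + (LinearMap.ker f).subtype ∘ₗ LinearMap.snd _ _ _
  have hA (x) : A x = a x.1 + x.2 := rfl
  have hB (y) : B y = c y.1 + y.2 := rfl
  have hker (x : LinearMap.ker g) : g x = 0 := x.2
  have hker' (x : LinearMap.ker f) : f x = 0 := x.2
  let A' : P × LinearMap.ker g →ₗ[S] LinearMap.ker f :=
    (LinearMap.fst _ _ _ - c ∘ₗ A).codRestrict _ fun x ↦ by
      rw [LinearMap.mem_ker, LinearMap.sub_apply, map_sub, LinearMap.comp_apply, hc, hA, map_add,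
        ha, hker, add_zero, LinearMap.fst_apply, sub_self]
  let B' : Q × LinearMap.ker f →ₗ[S] LinearMap.ker g :=
    (LinearMap.fst _ _ _ - a ∘ₗ B).codRestrict _ fun y ↦ by
      rw [LinearMap.mem_ker, LinearMap.sub_apply, map_sub, LinearMap.comp_apply, ha, hB, map_add,
        hc, hker', add_zero, LinearMap.fst_apply, sub_self]
  have hA' (x) : (A' x : P) = x.1 - c (A x) := rfl
  have hB' (y) : (B' y : Q) = y.1 - a (B y) := rfl
  refine ⟨LinearEquiv.ofLinearMap (A.prod A') (B.prod B') (LinearMap.ext fun y ↦ ?_)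
    (LinearMap.ext fun x ↦ ?_)⟩
  · have h1 : A (B y, B' y) = y.1 := by rw [hA, hB']; abel
    exact Prod.ext h1 (Subtype.ext (by
      change (A' (B y, B' y) : P) = y.2
      rw [hA', h1, hB]; exact add_sub_cancel_left _ _))
  · have h1 : B (A x, A' x) = x.1 := by rw [hB, hA']; abel
    exact Prod.ext h1 (Subtype.ext (by
      change (B' (A x, A' x) : Q) = x.2
      rw [hB', h1, hA]; exact add_sub_cancel_left _ _))

end Schanuel

section StablyFree

variable {S Q : Type*} [CommRing S] [Nontrivial S] [AddCommGroup Q] [Module S Q]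

theorem UnimodularCompletion.free_of_prod_equiv (hS : UnimodularCompletion S) {N : ℕ}
    (e : (Q × S) ≃ₗ[S] (Fin N → S)) : Module.Free S Q := by
  let π : (Fin N → S) →ₗ[S] S := LinearMap.snd S Q S ∘ₗ e.symm.toLinearMap
  let v := e (0, 1)
  have hv : ∃ u, u ⬝ᵥ v = 1 := by
    refine ⟨fun i ↦ π (Pi.single i 1), ?_⟩
    have h1 : π v = 1 := by simp [π, v]
    refine Eq.trans ?_ h1
    rw [LinearMap.pi_apply_eq_sum_univ π v]
    refine Finset.sum_congr rfl fun i _ ↦ ?_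
    rw [smul_eq_mul, mul_comm]
    refine congrArg (v i * π ·) (funext fun j ↦ ?_)
    simp [Pi.single_apply, eq_comm]
  obtain _ | N := N
  · obtain ⟨u, hu⟩ := hv
    simp at hu
  obtain ⟨M, hM, hMv⟩ := hS _ v 0 hv
  let e' := e.trans (Matrix.toLinearEquiv' M (M.invertibleOfIsUnitDet hM))
  have he0 (s : S) : e' (0, s) = Pi.single 0 s := by
    have : ((0 : Q), s) = s • ((0 : Q), (1 : S)) := by simp
    rw [this, map_smul]
    change s • (M *ᵥ v) = _
    rw [hMv]
    ext i
    simp [Pi.single_apply]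
  have hsplit (q : Q) (s : S) : e' (q, s) = e' (q, 0) + Pi.single 0 s := by
    rw [← he0, ← map_add]
    simp
  let f : Q →ₗ[S] (Fin N → S) :=
    LinearMap.funLeft S S Fin.succ ∘ₗ e'.toLinearMap ∘ₗ LinearMap.inl S Q S
  let g : (Fin N → S) → Q := fun w ↦ (e'.symm (Fin.cons 0 w)).1
  refine Module.Free.of_equiv (LinearEquiv.ofBijective f
    (Function.bijective_iff_has_inverse.mpr ⟨g, fun q ↦ ?_, fun w ↦ ?_⟩)).symm
  · have h1 : (Fin.cons 0 (f q) : Fin (N + 1) → S) = e' (q, -(e' (q, 0) 0)) := by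
      rw [hsplit]
      ext i
      cases i using Fin.cases <;> simp [f, LinearMap.funLeft]
    simp only [g]
    rw [h1]
    simp
  · have h1 := hsplit (e'.symm (Fin.cons 0 w)).1 (e'.symm (Fin.cons 0 w)).2
    rw [Prod.mk.eta, LinearEquiv.apply_symm_apply] at h1
    ext i
    have := congrFun h1 i.succ
    simpa [f, g, LinearMap.funLeft] using this.symm

theorem UnimodularCompletion.free_of_free_prod (hS : UnimodularCompletion S) {m N : ℕ}
    (e : (Q × (Fin m → S)) ≃ₗ[S] (Fin N → S)) : Module.Free S Q := by
  induction m generalizing N with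
  | zero =>
    exact Module.Free.of_equiv (e.symm.trans (LinearEquiv.prodUnique (R := S)))
  | succ m ih =>
    let c : (Fin (m + 1) → S) ≃ₗ[S] S × (Fin m → S) := (Fin.consLinearEquiv S fun _ ↦ S).symm
    let e1 : ((Q × (Fin m → S)) × S) ≃ₗ[S] (Fin N → S) :=
      (LinearEquiv.prodAssoc S Q (Fin m → S) S).trans
        (((LinearEquiv.refl S Q).prodCongr ((LinearEquiv.prodComm S _ _).trans c.symm)).trans e)
    have := hS.free_of_prod_equiv e1
    have hfin : Module.Finite S (Q × (Fin m → S)) :=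
      Module.Finite.of_surjective (LinearMap.fst S (Q × (Fin m → S)) S ∘ₗ e1.symm.toLinearMap)
        (Prod.fst_surjective.comp e1.symm.surjective)
    exact ih (Module.finBasis S (Q × (Fin m → S))).equivFun

end StablyFree

section PolynomialModule

variable {A : Type*} [CommRing A]

theorem Polynomial.Monic.add_divByMonic {g : Polynomial A} (hg : g.Monic) (p q : Polynomial A) :
    (p + q) /ₘ g = p /ₘ g + q /ₘ g := by
  apply hg.isRegular.left
  have h (r : Polynomial A) : g * (r /ₘ g) = r - r %ₘ g := by
    rw [Polynomial.modByMonic_eq_sub_mul_div, sub_sub_cancel]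
  simp only [mul_add, h, Polynomial.add_modByMonic]
  ring

theorem Polynomial.Monic.smul_divByMonic {g : Polynomial A} (hg : g.Monic) (a : A)
    (p : Polynomial A) : (a • p) /ₘ g = a • (p /ₘ g) := by
  apply hg.isRegular.left
  have h (r : Polynomial A) : g * (r /ₘ g) = r - r %ₘ g := by
    rw [Polynomial.modByMonic_eq_sub_mul_div, sub_sub_cancel]
  simp only [mul_smul_comm, h, Polynomial.smul_modByMonic, smul_sub]

variable {T : Type*} [AddCommGroup T] [Module (Polynomial A) T] [Module A T]
  [IsScalarTower A (Polynomial A) T]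

/-- A finite module over `A[X]` killed by a monic polynomial is finite over `A`. -/
theorem Module.Finite.of_monic_smul_eq_zero [Module.Finite (Polynomial A) T] {g : Polynomial A}
    (hg : g.Monic) (h : ∀ t : T, g • t = 0) : Module.Finite A T := by
  nontriviality A
  obtain ⟨k, f, hf⟩ := Module.Finite.exists_fin' (Polynomial A) T
  let L : (Fin k → Polynomial.degreeLT A g.natDegree) →ₗ[A] T :=
    (f.restrictScalars A) ∘ₗ
      LinearMap.pi fun i ↦ (Polynomial.degreeLT A g.natDegree).subtype ∘ₗ LinearMap.proj i
  have : Module.Finite A (Polynomial.degreeLT A g.natDegree) :=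
    Module.Finite.equiv (Polynomial.degreeLTEquiv A g.natDegree).symm
  refine Module.Finite.of_surjective L fun t ↦ ?_
  obtain ⟨w, rfl⟩ := hf t
  refine ⟨fun i ↦ ⟨w i %ₘ g, ?_⟩, ?_⟩
  · rw [Polynomial.mem_degreeLT, ← Polynomial.degree_eq_natDegree hg.ne_zero]
    exact Polynomial.degree_modByMonic_lt _ hg
  · change f (fun i ↦ w i %ₘ g) = f w
    have : w = (fun i ↦ w i %ₘ g) + g • (fun i ↦ w i /ₘ g) := by
      ext1 i
      exact (Polynomial.modByMonic_add_div _ g).symm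
    conv_rhs => rw [this, map_add, map_smul, h, add_zero]

/-- The characteristic presentation of an `A[X]`-module which is free over `A`. -/
theorem exists_presentation_of_basis [IsDomain A] {m : ℕ} (β : Module.Basis (Fin m) A T) :
    ∃ π : (Fin m → Polynomial A) →ₗ[Polynomial A] T, Function.Surjective π ∧
      Nonempty ((Fin m → Polynomial A) ≃ₗ[Polynomial A] LinearMap.ker π) := by
  let π := Fintype.linearCombination (Polynomial A) (fun i ↦ β i)
  let M : Matrix (Fin m) (Fin m) A :=
    Matrix.of fun i j ↦ β.repr ((Polynomial.X : Polynomial A) • β j) i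
  have hπ (w) : π w = ∑ i, w i • β i := Fintype.linearCombination_apply _ _ _
  have hπC (a : Fin m → A) : π (fun i ↦ Polynomial.C (a i)) = ∑ i, a i • β i := by
    rw [hπ]
    refine Finset.sum_congr rfl fun i _ ↦ ?_
    rw [← Polynomial.algebraMap_eq, algebraMap_smul]
  have hM (j) : ∑ i, Polynomial.C (M i j) • β i = (Polynomial.X : Polynomial A) • β j := by
    rw [← hπ, hπC]
    exact β.sum_repr _
  have hmem (w) : M.charmatrix.mulVecLin w ∈ LinearMap.ker π := by
    rw [LinearMap.mem_ker, hπ]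
    simp only [Matrix.mulVecLin_apply, Matrix.mulVec, dotProduct, Finset.sum_smul]
    rw [Finset.sum_comm]
    refine Finset.sum_eq_zero fun j _ ↦ ?_
    have : ∑ i, M.charmatrix i j • β i = 0 := by
      simp only [Matrix.charmatrix_apply, sub_smul, Finset.sum_sub_distrib, hM,
        Matrix.diagonal_apply, ite_smul, zero_smul]
      simp
    simp only [mul_comm _ (w j), mul_smul, ← Finset.smul_sum, this, smul_zero]
  have hC (a : Fin m → A) : M.charmatrix.mulVecLin (fun i ↦ Polynomial.C (a i)) =
      (Polynomial.X : Polynomial A) • (fun i ↦ Polynomial.C (a i)) -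
        fun i ↦ Polynomial.C ((M *ᵥ a) i) := by
    ext1 i
    simp [Matrix.mulVec, dotProduct, Matrix.charmatrix_apply, sub_mul, Finset.sum_sub_distrib,
      Matrix.diagonal_apply]
  have hconst (w : Fin m → Polynomial A) : ∃ (a : Fin m → A) (u : Fin m → Polynomial A),
      w = (fun i ↦ Polynomial.C (a i)) + M.charmatrix.mulVecLin u := by
    have hadd (w w' : Fin m → Polynomial A) (h : ∃ (a : Fin m → A) (u : Fin m → Polynomial A),
        w = (fun i ↦ Polynomial.C (a i)) + M.charmatrix.mulVecLin u)
        (h' : ∃ (a : Fin m → A) (u : Fin m → Polynomial A),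
        w' = (fun i ↦ Polynomial.C (a i)) + M.charmatrix.mulVecLin u) :
        ∃ (a : Fin m → A) (u : Fin m → Polynomial A),
        w + w' = (fun i ↦ Polynomial.C (a i)) + M.charmatrix.mulVecLin u := by
      obtain ⟨a, u, rfl⟩ := h
      obtain ⟨a', u', rfl⟩ := h'
      refine ⟨a + a', u + u', ?_⟩
      rw [map_add]
      ext1 i
      simp only [Pi.add_apply, map_add]
      ring
    have hX (p : Polynomial A) (w : Fin m → Polynomial A)
        (h : ∃ (a : Fin m → A) (u : Fin m → Polynomial A),
        w = (fun i ↦ Polynomial.C (a i)) + M.charmatrix.mulVecLin u) :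
        ∃ (a : Fin m → A) (u : Fin m → Polynomial A),
        p • w = (fun i ↦ Polynomial.C (a i)) + M.charmatrix.mulVecLin u := by
      induction p using Polynomial.induction_on generalizing w with
      | C b =>
        obtain ⟨a, u, rfl⟩ := h
        refine ⟨b • a, Polynomial.C b • u, ?_⟩
        rw [map_smul]
        ext1 i
        simp [mul_add]
      | add p q hp hq =>
        rw [add_smul]
        exact hadd _ _ (hp w h) (hq w h)
      | monomial n b ih =>
        rw [pow_succ, ← mul_assoc, mul_smul]
        refine ih _ ?_
        obtain ⟨a, u, rfl⟩ := h
        refine ⟨M *ᵥ a, (fun i ↦ Polynomial.C (a i)) + (Polynomial.X : Polynomial A) • u, ?_⟩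
        rw [map_add, map_smul, hC, smul_add]
        abel
    rw [pi_eq_sum_univ w]
    induction (Finset.univ : Finset (Fin m)) using Finset.induction_on with
    | empty => exact ⟨0, 0, by ext; simp⟩
    | insert j s hj ih =>
      rw [Finset.sum_insert hj]
      refine hadd _ _ (hX _ _ ⟨fun i ↦ if j = i then 1 else 0, 0, ?_⟩) ih
      ext1 i
      simp [apply_ite]
  refine ⟨π, fun t ↦ ⟨fun i ↦ Polynomial.C (β.repr t i), by rw [hπC]; exact β.sum_repr t⟩,
    ⟨LinearEquiv.ofBijective (M.charmatrix.mulVecLin.codRestrict _ hmem) ⟨?_, ?_⟩⟩⟩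
  · rw [injective_iff_map_eq_zero]
    intro w hw
    by_contra hne
    have := Matrix.exists_mulVec_eq_zero_iff.mp ⟨w, hne, congrArg Subtype.val hw⟩
    exact M.charpoly_monic.ne_zero this
  · rintro ⟨w, hw⟩
    obtain ⟨a, u, rfl⟩ := hconst w
    refine ⟨u, Subtype.ext ?_⟩
    have h0 : ∑ i, a i • β i = 0 := by
      rw [← hπC]
      rw [LinearMap.mem_ker, map_add, LinearMap.mem_ker.mp (hmem u), add_zero] at hw
      exact hw
    have ha := Fintype.linearIndependent_iff.mp β.linearIndependent a h0
    ext1 i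
    simp [ha]

end PolynomialModule

section FreeProjective

/-- Every finite projective module (in the universe of the ring) is free. -/
def FreeProjectives.{u} (S : Type u) [CommRing S] : Prop :=
  ∀ (P : Type u) [AddCommGroup P] [Module S P] [Module.Finite S P] [Module.Projective S P],
    Module.Free S P

theorem Module.Projective.restrictScalars_of_free (A S P : Type*) [CommRing A] [CommRing S]
    [Algebra A S] [AddCommGroup P] [Module S P] [Module A P] [IsScalarTower A S P]
    [Module.Free A S] [Module.Projective S P] : Module.Projective A P := by
  obtain ⟨s, hs⟩ := Module.projective_def'.mp (inferInstance : Module.Projective S P)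
  have : Module.Projective A (P →₀ S) := inferInstance
  refine Module.Projective.of_split (s.restrictScalars A)
    ((Finsupp.linearCombination S (id : P → P)).restrictScalars A) (LinearMap.ext fun p ↦ ?_)
  exact LinearMap.congr_fun hs p

theorem free_of_monic_smul_mem_span.{u} {A P : Type u} [CommRing A] [IsDomain A] [AddCommGroup P]
    [Module (Polynomial A) P] [Module A P] [IsScalarTower A (Polynomial A) P]
    [Module.Finite (Polynomial A) P] [Module.Projective (Polynomial A) P]
    (hA : FreeProjectives A) (hS : UnimodularCompletion (Polynomial A))
    {r : ℕ} {b : Fin r → P} (hb : LinearIndependent (Polynomial A) b) {g : Polynomial A}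
    (hg : g.Monic) (hgb : ∀ p, g • p ∈ Submodule.span (Polynomial A) (Set.range b)) :
    Module.Free (Polynomial A) P := by
  let N := Submodule.span (Polynomial A) (Set.range b)
  let β : Module.Basis (Fin r) (Polynomial A) N := Module.Basis.span hb
  let γ : P →ₗ[Polynomial A] N := (LinearMap.lsmul (Polynomial A) P g).codRestrict N hgb
  let σ₀ : P →ₗ[A] P :=
    { toFun := fun p ↦ p - ∑ i, (β.repr (γ p) i /ₘ g) • b i
      map_add' := fun p q ↦ by
        simp only [map_add, Finsupp.add_apply, hg.add_divByMonic, add_smul, Finset.sum_add_distrib]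
        abel
      map_smul' := fun a p ↦ by
        have h1 : γ (a • p) = (algebraMap A (Polynomial A) a) • γ p := by
          rw [← map_smul, algebraMap_smul]
        have h2 (i) : (β.repr (γ (a • p)) i /ₘ g) = a • (β.repr (γ p) i /ₘ g) := by
          rw [h1, map_smul, Finsupp.smul_apply, algebraMap_smul, hg.smul_divByMonic]
        simp only [h2, smul_assoc, ← Finset.smul_sum, RingHom.id_apply, smul_sub] }
  have hσ₀ (p) : σ₀ p = p - ∑ i, (β.repr (γ p) i /ₘ g) • b i := rfl
  have hσN : N.restrictScalars A ≤ LinearMap.ker σ₀ := fun p hp ↦ by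
    have h1 : γ p = g • (⟨p, hp⟩ : N) := Subtype.ext rfl
    have h2 := congrArg Subtype.val (β.sum_repr ⟨p, hp⟩)
    rw [LinearMap.mem_ker, hσ₀, h1, sub_eq_zero]
    simp only [map_smul, Finsupp.smul_apply, smul_eq_mul,
      Polynomial.mul_divByMonic_cancel_left _ hg]
    have hβ (i) : (β i : P) = b i :=
      congrArg Subtype.val (Module.Basis.span_apply hb i)
    refine h2.symm.trans ?_
    rw [Submodule.coe_sum]
    simp only [Submodule.coe_smul, hβ]
  have hmk (p) : N.mkQ (σ₀ p) = N.mkQ p := by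
    rw [hσ₀, map_sub, sub_eq_self, Submodule.mkQ_apply, Submodule.Quotient.mk_eq_zero]
    exact Submodule.sum_mem _ fun i _ ↦
      Submodule.smul_mem _ _ (Submodule.subset_span (Set.mem_range_self i))
  have : Module.Projective A P := Module.Projective.restrictScalars_of_free A (Polynomial A) P
  have : Module.Projective A (P ⧸ N) := by
    let e := Submodule.Quotient.restrictScalarsEquiv A N
    refine Module.Projective.of_split (((N.restrictScalars A).liftQ σ₀ hσN) ∘ₗ e.symm.toLinearMap)
      (N.mkQ.restrictScalars A) (LinearMap.ext fun t ↦ ?_)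
    obtain ⟨p, rfl⟩ := N.mkQ_surjective t
    exact hmk p
  have hker (t : P ⧸ N) : g • t = 0 := by
    obtain ⟨p, rfl⟩ := N.mkQ_surjective t
    rw [← map_smul, Submodule.mkQ_apply, Submodule.Quotient.mk_eq_zero]
    exact hgb p
  have : Module.Finite A (P ⧸ N) := Module.Finite.of_monic_smul_eq_zero hg hker
  have : Module.Free A (P ⧸ N) := hA _
  obtain ⟨π, hπ, ⟨e⟩⟩ := exists_presentation_of_basis (Module.finBasis A (P ⧸ N))
  obtain ⟨s⟩ := schanuel N.mkQ_surjective hπ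
  have e1 : LinearMap.ker N.mkQ ≃ₗ[Polynomial A] (Fin r → Polynomial A) :=
    (LinearEquiv.ofEq _ _ N.ker_mkQ).trans β.equivFun
  let e2 := ((LinearEquiv.refl (Polynomial A) P).prodCongr e).trans
    (s.trans ((LinearEquiv.refl (Polynomial A) _).prodCongr e1))
  exact hS.free_of_free_prod (e2.trans (Module.finBasis (Polynomial A) _).equivFun)

theorem exists_linearIndependent_smul_mem_span {S P : Type*} [CommRing S] [IsDomain S]
    [AddCommGroup P] [Module S P] [Module.Finite S P] :
    ∃ (r : ℕ) (b : Fin r → P) (g : S), LinearIndependent S b ∧ g ≠ 0 ∧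
      ∀ p, g • p ∈ Submodule.span S (Set.range b) := by
  classical
  obtain ⟨k, v, hv⟩ := Module.Finite.exists_fin (R := S) (M := P)
  obtain ⟨s, hs, hs'⟩ := exists_maximal_linearIndepOn S v
  have h (i) : ∃ a : S, a ≠ 0 ∧ a • v i ∈ Submodule.span S (v '' s) := by
    by_cases hi : i ∈ s
    · exact ⟨1, one_ne_zero, by
        rw [one_smul]; exact Submodule.subset_span (Set.mem_image_of_mem v hi)⟩
    · exact hs' i hi
  choose a ha0 ha using h
  let e := (Fintype.equivFin s).symm
  have hr : Set.range (fun i ↦ v (e i)) = v '' s := by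
    rw [Set.image_eq_range]
    exact e.surjective.range_comp (fun i : s ↦ v i)
  refine ⟨_, fun i ↦ v (e i), ∏ i, a i, hs.comp e e.injective,
    Finset.prod_ne_zero_iff.mpr fun i _ ↦ ha0 i, fun p ↦ ?_⟩
  rw [hr]
  have hp : p ∈ Submodule.span S (Set.range v) := hv ▸ Submodule.mem_top
  induction hp using Submodule.span_induction with
  | mem x hx =>
    obtain ⟨i, rfl⟩ := hx
    rw [← Finset.prod_erase_mul _ _ (Finset.mem_univ i), mul_smul]
    exact Submodule.smul_mem _ _ (ha i)
  | zero => simp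
  | add x y _ _ hx hy => rw [smul_add]; exact Submodule.add_mem _ hx hy
  | smul c x _ hx => rw [smul_comm]; exact Submodule.smul_mem _ _ hx

theorem FreeProjectives.of_ringEquiv.{u} {S S' : Type u} [CommRing S] [CommRing S'] (e : S ≃+* S')
    (h : FreeProjectives S) : FreeProjectives S' := by
  intro P _ _ _ _
  let _ : Module S P := Module.compHom P e.toRingHom
  have := RingHomInvPair.of_ringEquiv e
  have := RingHomInvPair.of_ringEquiv e.symm
  have hsm (s : S) (p : P) : s • p = e s • p := rfl
  let f : P ≃ₛₗ[(e : S →+* S')] P :=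
    { AddEquiv.refl P with map_smul' := fun s p ↦ rfl }
  have : Module.Finite S P := Module.Finite.of_surjective f.symm.toLinearMap f.symm.surjective
  have : Module.Projective S P := Module.Projective.of_equiv f.symm
  have := h P
  exact Module.Free.of_equiv f

theorem freeProjectives_mvPolynomial.{u} (K : Type u) [Field K] (n : ℕ) :
    FreeProjectives (MvPolynomial (Fin n) K) := by
  induction n with
  | zero =>
    refine FreeProjectives.of_ringEquiv (isEmptyAlgEquiv K (Fin 0)).toRingEquiv.symm ?_
    intro P _ _ _ _
    infer_instance
  | succ n ih =>
    intro P _ _ _ _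
    obtain ⟨r, b, g, hb, hg, hgb⟩ :=
      exists_linearIndependent_smul_mem_span (S := MvPolynomial (Fin (n + 1)) K) (P := P)
    obtain ⟨e, he⟩ := exists_equiv_isUnit_leadingCoeff hg
    obtain ⟨u, hu⟩ := he
    let A := MvPolynomial (Fin n) K
    let _ : Module (Polynomial A) P := Module.compHom P e.symm.toRingHom
    let _ : Module A P := Module.compHom P (algebraMap A (Polynomial A))
    have : IsScalarTower A (Polynomial A) P := IsScalarTower.of_compHom A (Polynomial A) P
    have := RingHomInvPair.of_ringEquiv e
    have := RingHomInvPair.of_ringEquiv e.symm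
    have hsm (s : Polynomial A) (p : P) : s • p = e.symm s • p := rfl
    let f : P ≃ₛₗ[(e : MvPolynomial (Fin (n + 1)) K →+* Polynomial A)] P :=
      { AddEquiv.refl P with
        map_smul' := fun s p ↦ by
          change s • p = e.symm (e s) • p
          rw [e.symm_apply_apply] }
    have : Module.Finite (Polynomial A) P := Module.Finite.of_surjective f.toLinearMap f.surjective
    have : Module.Projective (Polynomial A) P := Module.Projective.of_equiv f
    have hUC : UnimodularCompletion (Polynomial A) :=
      (unimodularCompletion_mvPolynomial K (n + 1)).of_ringEquiv (finSuccEquiv K n).toRingEquiv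
    have hmonic : (Polynomial.C (↑u⁻¹ : A) * e g).Monic := by
      rw [Polynomial.Monic, Polynomial.leadingCoeff_mul, Polynomial.leadingCoeff_C, ← hu,
        Units.inv_mul]
    have hspan (p : P) : p ∈ Submodule.span (MvPolynomial (Fin (n + 1)) K) (Set.range b) →
        p ∈ Submodule.span (Polynomial A) (Set.range b) := fun hp ↦ by
      induction hp using Submodule.span_induction with
      | mem x hx => exact Submodule.subset_span hx
      | zero => exact Submodule.zero_mem _
      | add x y _ _ hx hy => exact Submodule.add_mem _ hx hy
      | smul c x _ hx =>
        have : c • x = e c • x := by rw [hsm, e.symm_apply_apply]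
        rw [this]
        exact Submodule.smul_mem _ _ hx
    have hb' : LinearIndependent (Polynomial A) b := by
      rw [Fintype.linearIndependent_iff] at hb ⊢
      intro c hc i
      have := hb (fun i ↦ e.symm (c i)) hc i
      simpa using this
    have hfree : Module.Free (Polynomial A) P :=
      free_of_monic_smul_mem_span ih hUC hb' hmonic fun p ↦ by
        rw [mul_smul]
        refine Submodule.smul_mem _ _ (hspan _ ?_)
        have : e g • p = g • p := by rw [hsm, e.symm_apply_apply]
        rw [this]
        exact hgb p
    exact Module.Free.of_equiv f.symm

end FreeProjective

section Idempotent

/-- Idempotent matrices are diagonalisable when projective modules are free. -/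
theorem FreeProjectives.exists_diagonalization {R : Type*} [CommRing R] [Nontrivial R]
    (hR : FreeProjectives R) {l : ℕ} {H : Matrix (Fin l) (Fin l) R} (hH : H * H = H) :
    ∃ (W W' : Matrix (Fin l) (Fin l) R) (d : Fin l → R), W * W' = 1 ∧ W' * W = 1 ∧
      (∀ i, d i = 0 ∨ d i = 1) ∧ H * W = W * diagonal d := by
  let f : (Fin l → R) →ₗ[R] (Fin l → R) := H.mulVecLin
  have hff (v) : f (f v) = f v := by
    change H *ᵥ (H *ᵥ v) = H *ᵥ v
    rw [mulVec_mulVec, hH]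
  let ρ : (Fin l → R) →ₗ[R] LinearMap.range f := f.rangeRestrict
  let κ : (Fin l → R) →ₗ[R] LinearMap.ker f :=
    (LinearMap.id - f).codRestrict _ fun v ↦ by
      rw [LinearMap.mem_ker, LinearMap.sub_apply, map_sub, hff]
      exact sub_self _
  have hρ : ρ ∘ₗ (LinearMap.range f).subtype = LinearMap.id := by
    ext1 ⟨_, v, rfl⟩
    exact Subtype.ext (hff v)
  have hκ : κ ∘ₗ (LinearMap.ker f).subtype = LinearMap.id := by
    ext1 ⟨v, hv⟩
    refine Subtype.ext ?_
    change v - f v = v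
    rw [LinearMap.mem_ker.mp hv, sub_zero]
  have := Module.Projective.of_split _ _ hρ
  have := Module.Projective.of_split _ _ hκ
  have : Module.Finite R (LinearMap.range f) :=
    Module.Finite.of_surjective ρ fun x ↦ ⟨x, LinearMap.congr_fun hρ x⟩
  have : Module.Finite R (LinearMap.ker f) :=
    Module.Finite.of_surjective κ fun x ↦ ⟨x, LinearMap.congr_fun hκ x⟩
  have := hR (LinearMap.range f)
  have := hR (LinearMap.ker f)
  have hcompl : IsCompl (LinearMap.range f) (LinearMap.ker f) := by
    refine ⟨Submodule.disjoint_def.mpr ?_, codisjoint_iff_le_sup.mpr fun v _ ↦ ?_⟩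
    · rintro _ ⟨v, rfl⟩ hv
      exact (hff v).symm.trans hv
    · exact Submodule.mem_sup.mpr ⟨f v, ⟨v, rfl⟩, κ v, (κ v).2, add_sub_cancel _ _⟩
  let β₀ := ((Module.finBasis R (LinearMap.range f)).prod
    (Module.finBasis R (LinearMap.ker f))).map (Submodule.prodEquivOfIsCompl _ _ hcompl)
  let e : Fin (Module.finrank R (LinearMap.range f)) ⊕ Fin (Module.finrank R (LinearMap.ker f)) ≃
      Fin l := β₀.indexEquiv (Pi.basisFun R (Fin l))
  let β := β₀.reindex e
  let d₀ : Fin (Module.finrank R (LinearMap.range f)) ⊕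
      Fin (Module.finrank R (LinearMap.ker f)) → R := Sum.elim 1 0
  have hd₀ (i) : f (β₀ i) = d₀ i • β₀ i := by
    obtain i | i := i
    · obtain ⟨v, hv⟩ := (Module.finBasis R (LinearMap.range f) i).2
      have : β₀ (Sum.inl i) = Module.finBasis R (LinearMap.range f) i := by simp [β₀]
      rw [this, ← hv, hff]
      simp [d₀]
    · have : β₀ (Sum.inr i) = Module.finBasis R (LinearMap.ker f) i := by simp [β₀]
      rw [this]
      simp [d₀]
  refine ⟨(Pi.basisFun R (Fin l)).toMatrix β, β.toMatrix (Pi.basisFun R (Fin l)),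
    fun i ↦ d₀ (e.symm i), Module.Basis.toMatrix_mul_toMatrix_flip _ _,
    Module.Basis.toMatrix_mul_toMatrix_flip _ _, fun i ↦ ?_, ?_⟩
  · rcases h : e.symm i with j | j <;> simp [d₀, h]
  · ext i j
    rw [mul_diagonal]
    have := congrFun (hd₀ (e.symm j)) i
    rw [Pi.smul_apply, smul_eq_mul, mul_comm] at this
    refine Eq.trans ?_ (this.trans ?_)
    · simp [f, Matrix.mul_apply, mulVec, dotProduct, β, Module.Basis.toMatrix_apply]
    · simp [β, Module.Basis.toMatrix_apply]

end Idempotent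

section Minors

variable {R : Type*} [CommRing R] {l : ℕ}

theorem det_submatrix_eq_zero_or_mem_minorsSet {k : ℕ} (F : Matrix (Fin l) (Fin l) R)
    (ρ γ : Fin k → Fin l) :
    (F.submatrix ρ γ).det = 0 ∨ (F.submatrix ρ γ).det ∈ minorsSet k F := by
  by_cases hρ : Function.Injective ρ
  · by_cases hγ : Function.Injective γ
    · exact Or.inr ⟨ρ, γ, hρ, hγ, rfl⟩
    · simp only [Function.Injective, not_forall] at hγ
      obtain ⟨i, j, hij, hne⟩ := hγ
      exact Or.inl (det_zero_of_column_eq hne fun r ↦ congrArg (F (ρ r)) hij)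
  · simp only [Function.Injective, not_forall] at hρ
    obtain ⟨i, j, hij, hne⟩ := hρ
    exact Or.inl (det_zero_of_row_eq hne (funext fun r ↦ congrArg (F · (γ r)) hij))

theorem det_submatrix_mem_span_minorsSet {k : ℕ} (F : Matrix (Fin l) (Fin l) R)
    (ρ γ : Fin k → Fin l) : (F.submatrix ρ γ).det ∈ Ideal.span (minorsSet k F) := by
  obtain h | h := det_submatrix_eq_zero_or_mem_minorsSet F ρ γ
  · rw [h]
    exact Ideal.zero_mem _
  · exact Ideal.subset_span h

theorem submatrix_mul_adjugate_mul_submatrix [IsDomain R] {b : ℕ} {F : Matrix (Fin l) (Fin l) R}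
    (hF : ∀ m ∈ minorsSet (b + 1) F, m = 0) (I J : Fin b → Fin l)
    (hIJ : (F.submatrix I J).det ≠ 0) :
    F.submatrix id J * (F.submatrix I J).adjugate * F.submatrix I id =
      (F.submatrix I J).det • F := by
  ext r c
  set A := F.submatrix I J
  let a : Matrix Unit Unit R := F.submatrix (fun _ ↦ r) (fun _ ↦ c)
  let w : Matrix Unit (Fin b) R := F.submatrix (fun _ ↦ r) J
  let u : Matrix (Fin b) Unit R := F.submatrix I (fun _ ↦ c)
  have h0 : (fromBlocks a w u A).det = 0 := by
    let e : Fin (b + 1) ≃ Unit ⊕ Fin b :=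
      Fintype.equivOfCardEq (by rw [Fintype.card_sum]; simp [add_comm])
    have h1 : fromBlocks a w u A =
        F.submatrix (Sum.elim (fun _ ↦ r) I) (Sum.elim (fun _ ↦ c) J) := by
      ext (i | i) (j | j) <;> rfl
    rw [h1, ← det_submatrix_equiv_self e, submatrix_submatrix]
    obtain h | h := det_submatrix_eq_zero_or_mem_minorsSet F
      (Sum.elim (fun _ ↦ r) I ∘ e) (Sum.elim (fun _ ↦ c) J ∘ e)
    · exact h
    · exact hF _ h
  have h2 : fromBlocks a w u A * fromBlocks (A.det • 1) 0 (-(A.adjugate * u)) 1 =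
      fromBlocks (A.det • a - w * A.adjugate * u) w 0 A := by
    rw [fromBlocks_multiply]
    congr 1
    · simp [Matrix.mul_assoc, sub_eq_add_neg]
    · simp
    · rw [Matrix.mul_neg, ← Matrix.mul_assoc, mul_adjugate]
      simp
    · simp
  have h3 := congrArg det h2
  rw [det_mul, h0, zero_mul, det_fromBlocks_zero₂₁] at h3
  have h4 := (mul_eq_zero.mp h3.symm).resolve_right hIJ
  rw [det_unique] at h4
  exact (sub_eq_zero.mp h4).symm

theorem exists_mul_mul_eq_smul [IsDomain R] {b : ℕ} {F : Matrix (Fin l) (Fin l) R}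
    (hF : ∀ m ∈ minorsSet (b + 1) F, m = 0) {δ m : R} (hδ : ∀ m ∈ minorsSet b F, δ ∣ m)
    (hm : m ∈ Ideal.span (minorsSet b F)) :
    ∃ G : Matrix (Fin l) (Fin l) R, F * (G * F) = m • F ∧ ∀ i j, δ ∣ (G * F) i j := by
  induction hm using Submodule.span_induction with
  | mem m hm =>
    obtain ⟨I, J, -, -, rfl⟩ := hm
    by_cases hIJ : (F.submatrix I J).det = 0
    · exact ⟨0, by simp [hIJ], by simp⟩
    · refine ⟨(1 : Matrix (Fin l) (Fin l) R).submatrix id J * (F.submatrix I J).adjugate *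
        (1 : Matrix (Fin l) (Fin l) R).submatrix I id, ?_, fun i c ↦ ?_⟩
      · rw [← submatrix_mul_adjugate_mul_submatrix hF I J hIJ]
        have h1 : F.submatrix id J = F * (1 : Matrix (Fin l) (Fin l) R).submatrix id J := by
          ext i j
          simp [Matrix.mul_apply, Matrix.one_apply]
        have h2 : F.submatrix I id = (1 : Matrix (Fin l) (Fin l) R).submatrix I id * F := by
          ext i j
          simp [Matrix.mul_apply, Matrix.one_apply]
        rw [h1, h2]
        simp only [Matrix.mul_assoc]
      · have h2 : F.submatrix I id = (1 : Matrix (Fin l) (Fin l) R).submatrix I id * F := by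
          ext i j
          simp [Matrix.mul_apply, Matrix.one_apply]
        rw [Matrix.mul_assoc, ← h2, Matrix.mul_assoc, Matrix.mul_apply]
        refine Finset.dvd_sum fun k _ ↦ dvd_mul_of_dvd_right ?_ _
        have h3 : ((F.submatrix I J).adjugate * F.submatrix I id) k c =
            (F.submatrix I (Function.update J k c)).det := by
          change ((F.submatrix I J).adjugate *ᵥ fun i ↦ F (I i) c) k = _
          rw [← cramer_eq_adjugate_mulVec, cramer_apply]
          congr 1
          ext i j
          obtain rfl | hj := eq_or_ne j k
          · simp
          · simp [hj]
        rw [h3]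
        obtain h | h := det_submatrix_eq_zero_or_mem_minorsSet F I (Function.update J k c)
        · rw [h]; exact dvd_zero _
        · exact hδ _ h
  | zero => exact ⟨0, by simp, by simp⟩
  | add x y _ _ hx hy =>
    obtain ⟨G, hG, hG'⟩ := hx
    obtain ⟨G₂, hG₂, hG₂'⟩ := hy
    refine ⟨G + G₂, by rw [Matrix.add_mul, Matrix.mul_add, hG, hG₂, add_smul], fun i j ↦ ?_⟩
    rw [Matrix.add_mul]
    exact dvd_add (hG' i j) (hG₂' i j)
  | smul c x _ hx =>
    obtain ⟨G, hG, hG'⟩ := hx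
    refine ⟨c • G, by rw [Matrix.smul_mul, Matrix.mul_smul, hG, smul_assoc], fun i j ↦ ?_⟩
    rw [Matrix.smul_mul]
    exact dvd_mul_of_dvd_right (hG' i j) _

theorem exists_idempotent_of_minors [IsDomain R] {b : ℕ} {F : Matrix (Fin l) (Fin l) R}
    (hF : ∀ m ∈ minorsSet (b + 1) F, m = 0) {δ : R} (hδ0 : δ ≠ 0)
    (hI : Ideal.span (minorsSet b F) = Ideal.span {δ}) :
    ∃ G H : Matrix (Fin l) (Fin l) R, F * H = F ∧ δ • H = G * F ∧ H * H = H := by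
  have hδ : ∀ m ∈ minorsSet b F, δ ∣ m := fun m hm ↦
    Ideal.mem_span_singleton.mp (hI ▸ Ideal.subset_span hm)
  obtain ⟨G, hG, hG'⟩ := exists_mul_mul_eq_smul hF hδ (hI ▸ Ideal.mem_span_singleton_self δ)
  choose H hH using hG'
  have hH' : δ • of H = G * F := by
    ext i j
    exact (hH i j).symm
  have hFH : F * of H = F := by
    apply smul_right_injective _ hδ0
    change δ • (F * of H) = δ • F
    rw [← Matrix.mul_smul, hH', hG]
  refine ⟨G, of H, hFH, hH', ?_⟩
  apply smul_right_injective _ hδ0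
  change δ • (of H * of H) = δ • of H
  rw [← Matrix.smul_mul, hH', Matrix.mul_assoc, hFH]

end Minors

section MinorsIdeal

variable {R : Type*} [CommRing R] {l : ℕ}

/-- The ideal generated by the minors of a given order. -/
abbrev minorsIdeal (k : ℕ) (F : Matrix (Fin l) (Fin l) R) : Ideal R := Ideal.span (minorsSet k F)

theorem det_mul_submatrix_mem {k : ℕ} (A : Matrix (Fin k) (Fin l) R) (F : Matrix (Fin l) (Fin l) R)
    (γ : Fin k → Fin l) : (A * F.submatrix id γ).det ∈ minorsIdeal k F := by
  have h : A * F.submatrix id γ = fun i ↦ ∑ j, A i j • fun c ↦ F j (γ c) := by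
    ext i c
    simp [Matrix.mul_apply]
  rw [h]
  change detRowAlternating.toMultilinearMap (fun i ↦ ∑ j, A i j • fun c ↦ F j (γ c)) ∈ _
  rw [MultilinearMap.map_sum]
  refine Ideal.sum_mem _ fun r _ ↦ ?_
  rw [MultilinearMap.map_smul_univ]
  exact Ideal.mul_mem_left _ _ (det_submatrix_mem_span_minorsSet F r γ)

theorem minorsIdeal_mul_le_right (k : ℕ) (A F : Matrix (Fin l) (Fin l) R) :
    minorsIdeal k (A * F) ≤ minorsIdeal k F := by
  refine Ideal.span_le.mpr ?_
  rintro _ ⟨ρ, γ, -, -, rfl⟩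
  exact det_mul_submatrix_mem (A.submatrix ρ id) F γ

theorem minorsIdeal_transpose (k : ℕ) (F : Matrix (Fin l) (Fin l) R) :
    minorsIdeal k Fᵀ = minorsIdeal k F := by
  refine congrArg Ideal.span (Set.ext fun d ↦ ?_)
  constructor
  · rintro ⟨ρ, γ, hρ, hγ, rfl⟩
    exact ⟨γ, ρ, hγ, hρ, by rw [← transpose_submatrix, det_transpose]⟩
  · rintro ⟨ρ, γ, hρ, hγ, rfl⟩
    exact ⟨γ, ρ, hγ, hρ, by rw [← transpose_submatrix, det_transpose]⟩

theorem minorsIdeal_mul_le_left (k : ℕ) (F A : Matrix (Fin l) (Fin l) R) :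
    minorsIdeal k (F * A) ≤ minorsIdeal k F := by
  rw [← minorsIdeal_transpose k (F * A), transpose_mul, ← minorsIdeal_transpose k F]
  exact minorsIdeal_mul_le_right k _ _

theorem MatEquiv.refl (F : Matrix (Fin l) (Fin l) R) : MatEquiv F F :=
  ⟨1, 1, by simp, by simp, by simp⟩

theorem MatEquiv.symm {F G : Matrix (Fin l) (Fin l) R} (h : MatEquiv F G) : MatEquiv G F := by
  obtain ⟨M, N, hM, hN, rfl⟩ := h
  refine ⟨M⁻¹, N⁻¹, by rwa [isUnit_nonsing_inv_det_iff], by rwa [isUnit_nonsing_inv_det_iff], ?_⟩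
  rw [Matrix.mul_assoc M, nonsing_inv_mul_cancel_left _ _ hM, mul_nonsing_inv_cancel_right _ _ hN]

theorem MatEquiv.trans {F G H : Matrix (Fin l) (Fin l) R} (h : MatEquiv F G) (h' : MatEquiv G H) :
    MatEquiv F H := by
  obtain ⟨M, N, hM, hN, rfl⟩ := h
  obtain ⟨M', N', hM', hN', rfl⟩ := h'
  refine ⟨M' * M, N * N', ?_, ?_, by simp only [Matrix.mul_assoc]⟩
  · rw [det_mul]; exact hM'.mul hM
  · rw [det_mul]; exact hN.mul hN'

theorem MatEquiv.smul {F G : Matrix (Fin l) (Fin l) R} (h : MatEquiv F G) (d : R) :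
    MatEquiv (d • F) (d • G) := by
  obtain ⟨M, N, hM, hN, rfl⟩ := h
  exact ⟨M, N, hM, hN, by rw [Matrix.mul_smul, Matrix.smul_mul]⟩

theorem MatEquiv.minorsIdeal_eq {F G : Matrix (Fin l) (Fin l) R} (h : MatEquiv F G) (k : ℕ) :
    minorsIdeal k F = minorsIdeal k G := by
  have key {F G : Matrix (Fin l) (Fin l) R} (h : MatEquiv F G) :
      minorsIdeal k G ≤ minorsIdeal k F := by
    obtain ⟨M, N, -, -, rfl⟩ := h
    exact (minorsIdeal_mul_le_left k _ _).trans (minorsIdeal_mul_le_right k _ _)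
  exact le_antisymm (key h.symm) (key h)

theorem minorsIdeal_zero (F : Matrix (Fin l) (Fin l) R) : minorsIdeal 0 F = ⊤ := by
  rw [Ideal.eq_top_iff_one]
  exact Ideal.subset_span
    ⟨Fin.elim0, Fin.elim0, fun i ↦ i.elim0, fun i ↦ i.elim0, det_fin_zero.symm⟩

theorem minorsIdeal_succ_le (k : ℕ) (F : Matrix (Fin l) (Fin l) R) :
    minorsIdeal (k + 1) F ≤ minorsIdeal k F := by
  refine Ideal.span_le.mpr ?_
  rintro _ ⟨ρ, γ, -, -, rfl⟩
  rw [det_succ_row_zero]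
  refine Ideal.sum_mem _ fun j _ ↦ Ideal.mul_mem_left _ _ ?_
  rw [submatrix_submatrix]
  exact det_submatrix_mem_span_minorsSet F _ _

theorem mem_minorsIdeal_one (F : Matrix (Fin l) (Fin l) R) (i j : Fin l) :
    F i j ∈ minorsIdeal 1 F := by
  have := det_submatrix_mem_span_minorsSet F (fun _ : Fin 1 ↦ i) (fun _ ↦ j)
  simpa using this

theorem minorsIdeal_self (F : Matrix (Fin l) (Fin l) R) : minorsIdeal l F = Ideal.span {F.det} := by
  refine le_antisymm (Ideal.span_le.mpr ?_) (Ideal.span_le.mpr ?_)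
  · rintro _ ⟨ρ, γ, hρ, hγ, rfl⟩
    let e := Equiv.ofBijective ρ (Finite.injective_iff_bijective.mp hρ)
    let e' := Equiv.ofBijective γ (Finite.injective_iff_bijective.mp hγ)
    have h1 : F.submatrix ρ γ = (F.submatrix id (e.symm.trans e')).submatrix e e := by
      ext i j
      simp [e, e']
    have h2 := det_permute' (e.symm.trans e') F
    rw [h1, det_submatrix_equiv_self, h2]
    exact Ideal.mul_mem_left _ _ (Ideal.mem_span_singleton_self _)
  · rw [Set.singleton_subset_iff]
    exact det_submatrix_mem_span_minorsSet F id id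

theorem minorsIdeal_smul (k : ℕ) (d : R) (F : Matrix (Fin l) (Fin l) R) :
    minorsIdeal k (d • F) = Ideal.span {d ^ k} * minorsIdeal k F := by
  rw [Ideal.span_mul_span', Set.singleton_mul]
  refine congrArg Ideal.span (Set.ext fun m ↦ ?_)
  constructor
  · rintro ⟨ρ, γ, hρ, hγ, rfl⟩
    refine ⟨_, ⟨ρ, γ, hρ, hγ, rfl⟩, ?_⟩
    rw [submatrix_smul]
    simp
  · rintro ⟨_, ⟨ρ, γ, hρ, hγ, rfl⟩, rfl⟩
    refine ⟨ρ, γ, hρ, hγ, ?_⟩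
    rw [submatrix_smul]
    simp

theorem minorsIdeal_map {S : Type*} [CommRing S] (φ : R →+* S) (k : ℕ)
    (F : Matrix (Fin l) (Fin l) R) :
    minorsIdeal k (F.map φ) = (minorsIdeal k F).map φ := by
  rw [Ideal.map_span]
  refine congrArg Ideal.span (Set.ext fun m ↦ ?_)
  constructor
  · rintro ⟨ρ, γ, hρ, hγ, rfl⟩
    exact ⟨_, ⟨ρ, γ, hρ, hγ, rfl⟩, by rw [RingHom.map_det]; rfl⟩
  · rintro ⟨_, ⟨ρ, γ, hρ, hγ, rfl⟩, rfl⟩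
    exact ⟨ρ, γ, hρ, hγ, by rw [RingHom.map_det]; rfl⟩

/-- The block diagonal matrix `diag(1, F)`. -/
def oneBlock (F : Matrix (Fin l) (Fin l) R) : Matrix (Fin (l + 1)) (Fin (l + 1)) R :=
  of (Fin.cons (Fin.cons 1 0) fun i ↦ Fin.cons 0 (F i))

@[simp] theorem oneBlock_zero_zero (F : Matrix (Fin l) (Fin l) R) : oneBlock F 0 0 = 1 := rfl

@[simp] theorem oneBlock_zero_succ (F : Matrix (Fin l) (Fin l) R) (j : Fin l) :
    oneBlock F 0 j.succ = 0 := rfl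

@[simp] theorem oneBlock_succ_zero (F : Matrix (Fin l) (Fin l) R) (i : Fin l) :
    oneBlock F i.succ 0 = 0 := rfl

@[simp] theorem oneBlock_succ_succ (F : Matrix (Fin l) (Fin l) R) (i j : Fin l) :
    oneBlock F i.succ j.succ = F i j := rfl

theorem oneBlock_mul (F G : Matrix (Fin l) (Fin l) R) :
    oneBlock (F * G) = oneBlock F * oneBlock G := by
  ext i j
  cases i using Fin.cases <;> cases j using Fin.cases <;>
    simp [Matrix.mul_apply, Fin.sum_univ_succ]

theorem det_oneBlock (F : Matrix (Fin l) (Fin l) R) : (oneBlock F).det = F.det := by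
  rw [det_succ_row_zero, Fin.sum_univ_succ]
  simp only [oneBlock_zero_zero, oneBlock_zero_succ, mul_zero, zero_mul, Finset.sum_const_zero,
    add_zero, Fin.val_zero, pow_zero, one_mul]
  rfl

theorem MatEquiv.oneBlock {F G : Matrix (Fin l) (Fin l) R} (h : MatEquiv F G) :
    MatEquiv (oneBlock F) (_root_.oneBlock G) := by
  obtain ⟨M, N, hM, hN, rfl⟩ := h
  exact ⟨_root_.oneBlock M, _root_.oneBlock N, by rwa [det_oneBlock], by rwa [det_oneBlock],
    by rw [oneBlock_mul, oneBlock_mul]⟩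

theorem oneBlock_diagonal (d : Fin l → R) :
    oneBlock (diagonal d) = diagonal (Fin.cons 1 d) := by
  ext i j
  cases i using Fin.cases <;> cases j using Fin.cases <;>
    simp [diagonal_apply, (Fin.succ_ne_zero _).symm]

theorem minorsIdeal_oneBlock (k : ℕ) (F : Matrix (Fin l) (Fin l) R) :
    minorsIdeal (k + 1) (oneBlock F) = minorsIdeal k F := by
  have hsucc {m : ℕ} {ρ : Fin m → Fin (l + 1)} (h : ∀ i, ρ i ≠ 0) :
      ∃ ρ' : Fin m → Fin l, ρ = Fin.succ ∘ ρ' := by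
    choose ρ' h' using fun i ↦ Fin.exists_succ_eq.mpr (h i)
    exact ⟨ρ', funext fun i ↦ (h' i).symm⟩
  refine le_antisymm (Ideal.span_le.mpr ?_) (Ideal.span_le.mpr ?_)
  · rintro _ ⟨ρ, γ, hρ, hγ, rfl⟩
    by_cases h0 : ∃ a, ρ a = 0
    · obtain ⟨a, ha⟩ := h0
      rw [det_succ_row _ a]
      refine Ideal.sum_mem _ fun j _ ↦ ?_
      by_cases hj : γ j = 0
      · refine Ideal.mul_mem_left _ _ ?_
        obtain ⟨ρ', hρ'⟩ := hsucc (ρ := ρ ∘ a.succAbove) fun i hi ↦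
          Fin.succAbove_ne a i (hρ (hi.trans ha.symm))
        obtain ⟨γ', hγ'⟩ := hsucc (ρ := γ ∘ j.succAbove) fun i hi ↦
          Fin.succAbove_ne j i (hγ (hi.trans hj.symm))
        rw [submatrix_submatrix, hρ', hγ']
        exact det_submatrix_mem_span_minorsSet F ρ' γ'
      · obtain ⟨c, hc⟩ := Fin.exists_succ_eq.mpr hj
        rw [submatrix_apply, ha, ← hc]
        simp
    · obtain ⟨ρ', rfl⟩ := hsucc (not_exists.mp h0)
      by_cases h1 : ∃ c, γ c = 0
      · obtain ⟨c, hc⟩ := h1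
        rw [det_eq_zero_of_column_eq_zero c fun i ↦ by simp [hc]]
        exact Ideal.zero_mem _
      · obtain ⟨γ', rfl⟩ := hsucc (not_exists.mp h1)
        exact minorsIdeal_succ_le k F (det_submatrix_mem_span_minorsSet F ρ' γ')
  · rintro _ ⟨ρ, γ, -, -, rfl⟩
    have : (F.submatrix ρ γ).det = ((oneBlock F).submatrix
        (Fin.cons 0 (Fin.succ ∘ ρ)) (Fin.cons 0 (Fin.succ ∘ γ))).det := by
      rw [← det_oneBlock]
      congr 1
      ext i j
      cases i using Fin.cases <;> cases j using Fin.cases <;> simp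
    rw [this]
    exact det_submatrix_mem_span_minorsSet _ _ _

/-- If `F v` and `v` are unimodular, then `F` is equivalent to some `diag(1, F')`. -/
theorem UnimodularCompletion.exists_matEquiv_oneBlock (hR : UnimodularCompletion R)
    {F : Matrix (Fin (l + 1)) (Fin (l + 1)) R} {u v : Fin (l + 1) → R}
    (h : u ⬝ᵥ F *ᵥ v = 1) : ∃ F' : Matrix (Fin l) (Fin l) R, MatEquiv F (oneBlock F') := by
  obtain ⟨M, hM, hMv⟩ := hR _ v 0 ⟨u ᵥ* F, by rw [← dotProduct_mulVec, h]⟩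
  obtain ⟨N, hN, hNv⟩ := hR _ (F *ᵥ v) 0 ⟨u, h⟩
  let G := N * F * M⁻¹
  have hG : G *ᵥ Pi.single 0 1 = Pi.single 0 1 := by
    rw [← hMv]
    simp only [G]
    rw [mulVec_mulVec, nonsing_inv_mul_cancel_right _ _ hM, ← mulVec_mulVec, hNv, hMv]
  have hG0 (i) : G i 0 = (Pi.single 0 1 : Fin (l + 1) → R) i := by
    rw [← hG]
    simp
  let L : Matrix (Fin (l + 1)) (Fin (l + 1)) R :=
    of (Fin.cons (Fin.cons 1 fun j ↦ -G 0 j.succ) fun i ↦ Fin.cons 0 ((1 : Matrix _ _ R) i))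
  have hL : L.det = 1 := by
    rw [det_succ_column_zero, Fin.sum_univ_succ]
    have h1 : (L.submatrix (Fin.succAbove 0) Fin.succ) = 1 := rfl
    rw [h1]
    simp [L]
  have hGe : MatEquiv F G :=
    ⟨N, M⁻¹, hN, by rwa [isUnit_nonsing_inv_det_iff], rfl⟩
  refine ⟨of fun i j ↦ G i.succ j.succ, hGe.trans ⟨1, L, by simp, by simp [hL], ?_⟩⟩
  rw [Matrix.one_mul]
  ext i j
  cases i using Fin.cases <;> cases j using Fin.cases <;>
    simp [Matrix.mul_apply, Fin.sum_univ_succ, L, hG0, Matrix.one_apply]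

end MinorsIdeal

section KeyStep

variable {R : Type*} [CommRing R] {l : ℕ}

/-- Two commuting retractions of a ring `R` with kernels generated by `x` and by `y`. -/
structure IsRetractionPair (x y : R) (φ ψ : R →+* R) : Prop where
  left_idem (r : R) : φ (φ r) = φ r
  right_idem (r : R) : ψ (ψ r) = ψ r
  comm (r : R) : φ (ψ r) = ψ (φ r)
  left_self : φ x = 0
  right_self : ψ y = 0
  left_other : φ y = y
  right_other : ψ x = x
  dvd_left (r : R) : x ∣ r - φ r
  dvd_right (r : R) : y ∣ r - ψ r

theorem IsRetractionPair.symm {x y : R} {φ ψ : R →+* R} (h : IsRetractionPair x y φ ψ) :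
    IsRetractionPair y x ψ φ :=
  ⟨h.right_idem, h.left_idem, fun r ↦ (h.comm r).symm, h.right_self, h.left_self, h.right_other,
    h.left_other, h.dvd_right, h.dvd_left⟩

theorem eq_zero_of_mem_minorsSet_map {φ : R →+* R} {x : R} (hx : φ x = 0) {k : ℕ}
    {F : Matrix (Fin l) (Fin l) R} (hF : minorsIdeal k F ≤ Ideal.span {x}) :
    ∀ m ∈ minorsSet k (F.map φ), m = 0 := by
  intro m hm
  have h1 : minorsIdeal k (F.map φ) ≤ ⊥ := by
    rw [minorsIdeal_map]
    refine (Ideal.map_mono hF).trans ?_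
    rw [Ideal.map_span, Set.image_singleton, hx, Set.singleton_zero, Ideal.span_zero]
  exact h1 (Ideal.subset_span hm)

theorem mem_sup_span_of_dotProduct_map {φ : R →+* R} {x : R} (hx : ∀ r, x ∣ r - φ r)
    {w u : Fin l → R} {z : R} (h : u ⬝ᵥ (φ ∘ w) = z) :
    z ∈ Ideal.span (Set.range w) ⊔ Ideal.span {x} := by
  have h1 : z = u ⬝ᵥ w - u ⬝ᵥ (w - φ ∘ w) := by
    rw [dotProduct_sub, h]
    abel
  rw [h1]
  refine Ideal.sub_mem _ (Ideal.mem_sup_left ?_) (Ideal.mem_sup_right ?_)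
  · exact Ideal.mem_span_range_iff_exists_fun.mpr ⟨u, rfl⟩
  · exact Ideal.mem_span_singleton.mpr
      (Finset.dvd_sum fun i _ ↦ dvd_mul_of_dvd_right (hx _) _)

theorem FreeProjectives.exists_unimodular_map [IsDomain R] (hR : FreeProjectives R)
    {φ : R →+* R} (hφ : ∀ r, φ (φ r) = φ r) {x : R} (hx : φ x = 0) {i : ℕ}
    {F : Matrix (Fin l) (Fin l) R} (h1 : minorsIdeal 1 F = ⊤) (hi : minorsIdeal i F = ⊤)
    (hi' : minorsIdeal (i + 1) F ≤ Ideal.span {x}) :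
    ∃ c u : Fin l → R, φ ∘ c = c ∧ u ⬝ᵥ F.map φ *ᵥ c = 1 := by
  obtain ⟨G, H, hFH, hGF, hH⟩ := exists_idempotent_of_minors (F := F.map φ) (δ := 1) (b := i)
    (eq_zero_of_mem_minorsSet_map hx hi') one_ne_zero
    ((minorsIdeal_map φ i F).trans (by rw [hi, Ideal.map_top, Ideal.span_singleton_one]))
  obtain ⟨W, W', d, hWW', hW'W, hd, hHW⟩ := hR.exists_diagonalization hH
  have hj : ∃ j, d j = 1 := by
    by_contra! hne
    have hd0 : d = 0 := funext fun j ↦ (hd j).resolve_right (hne j)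
    have hH0 : H = 0 := by
      rw [hd0, show diagonal (0 : Fin l → R) = 0 from diagonal_zero, Matrix.mul_zero] at hHW
      rw [← Matrix.mul_one H, ← hWW', ← Matrix.mul_assoc, hHW, Matrix.zero_mul]
    have hF0 : F.map φ = 0 := by rw [← hFH, hH0, Matrix.mul_zero]
    have h2 : minorsIdeal 1 (F.map φ) ≤ ⊥ := by
      rw [hF0]
      refine Ideal.span_le.mpr ?_
      rintro _ ⟨ρ, γ, -, -, rfl⟩
      simp
    rw [minorsIdeal_map, h1, Ideal.map_top, top_le_iff] at h2
    exact bot_ne_top h2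
  obtain ⟨j, hj⟩ := hj
  have hc : H *ᵥ (W.col j) = W.col j := by
    ext r
    have := congrFun (congrFun hHW r) j
    rw [mul_diagonal, hj, mul_one] at this
    exact this
  have hu : (W' j ᵥ* G) ⬝ᵥ F.map φ *ᵥ W.col j = 1 := by
    rw [← dotProduct_mulVec, mulVec_mulVec, ← hGF, one_smul, hc]
    have := congrFun (congrFun hW'W j) j
    rwa [one_apply_eq] at this
  refine ⟨φ ∘ W.col j, φ ∘ (W' j ᵥ* G), funext fun r ↦ hφ _, ?_⟩
  have := congrArg φ hu
  rw [RingHom.map_dotProduct, map_one] at this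
  rw [← this]
  congr 1
  ext r
  rw [Function.comp_apply, RingHom.map_mulVec, Matrix.map_map]
  congr 2
  ext i
  exact (hφ _).symm

theorem FreeProjectives.exists_dotProduct_mulVec_eq_one [IsDomain R] (hR : FreeProjectives R)
    {x y : R} {φ ψ : R →+* R} (h : IsRetractionPair x y φ ψ) (hx0 : x ≠ 0)
    {F : Matrix (Fin l) (Fin l) R} {p q : ℕ} (hdet : F.det ∣ x ^ p * y ^ q)
    (h1 : minorsIdeal 1 F = ⊤) {i j k : ℕ} (hi : minorsIdeal i F = ⊤)
    (hi' : minorsIdeal (i + 1) F ≤ Ideal.span {x}) (hj : minorsIdeal j F = Ideal.span {x ^ k})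
    (hj' : minorsIdeal (j + 1) F ≤ Ideal.span {y}) :
    ∃ u v : Fin l → R, u ⬝ᵥ F *ᵥ v = 1 := by
  obtain ⟨c, u₀, hc, hu₀⟩ := hR.exists_unimodular_map h.left_idem h.left_self h1 hi hi'
  obtain ⟨G, H₀, hFH₀, hGF, hH₀⟩ := exists_idempotent_of_minors (F := F.map ψ) (δ := x ^ k) (b := j)
    (eq_zero_of_mem_minorsSet_map h.right_self hj') (pow_ne_zero _ hx0)
    ((minorsIdeal_map ψ j F).trans (by
      rw [hj, Ideal.map_span, Set.image_singleton, map_pow, h.right_other]))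
  obtain ⟨W₀, W₀', d, hWW₀, hWW₀', hd, hHW₀⟩ := hR.exists_diagonalization hH₀
  have hψψ {m n : ℕ} (A : Matrix (Fin m) (Fin n) R) : (A.map ψ).map ψ = A.map ψ := by
    ext; exact h.right_idem _
  have hφφ {m n : ℕ} (A : Matrix (Fin m) (Fin n) R) : (A.map φ).map φ = A.map φ := by
    ext; exact h.left_idem _
  have hφψ {m n : ℕ} (A : Matrix (Fin m) (Fin n) R) : (A.map φ).map ψ = (A.map ψ).map φ := by
    ext; exact (h.comm _).symm
  have hdiag (χ : R →+* R) : (diagonal d).map χ = diagonal d := by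
    rw [diagonal_map (map_zero χ)]
    congr 1
    ext i
    obtain h | h := hd i <;> simp [h]
  obtain ⟨H, hH⟩ : ∃ H, H = H₀.map ψ := ⟨_, rfl⟩
  obtain ⟨W, hW⟩ : ∃ W, W = W₀.map ψ := ⟨_, rfl⟩
  obtain ⟨W', hW'⟩ : ∃ W', W' = W₀'.map ψ := ⟨_, rfl⟩
  have hWψ : W.map ψ = W := by rw [hW, hψψ]
  have hWψ' : W'.map ψ = W' := by rw [hW', hψψ]
  have hWW' : W * W' = 1 := by
    rw [hW, hW', ← Matrix.map_mul, hWW₀, Matrix.map_one _ (map_zero ψ) (map_one ψ)]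
  have hW'W : W' * W = 1 := by
    rw [hW, hW', ← Matrix.map_mul, hWW₀', Matrix.map_one _ (map_zero ψ) (map_one ψ)]
  have hHW : H * W = W * diagonal d := by
    rw [hH, hW, ← Matrix.map_mul, hHW₀, Matrix.map_mul, hdiag]
  have hFH : F.map ψ * H = F.map ψ := by
    have := congrArg (·.map ψ) hFH₀
    simp only [Matrix.map_mul, hψψ] at this
    rwa [hH]
  have hGH : (G.map ψ) * F.map ψ = x ^ k • H := by
    have := congrArg (·.map ψ) hGF
    simp only [Matrix.map_mul, hψψ] at this
    rw [← this, hH]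
    ext
    simp [h.right_other]
  have hφW : W.map φ * W'.map φ = 1 := by
    rw [← Matrix.map_mul, hWW', Matrix.map_one _ (map_zero φ) (map_one φ)]
  have hφW' : W'.map φ * W.map φ = 1 := by
    rw [← Matrix.map_mul, hW'W, Matrix.map_one _ (map_zero φ) (map_one φ)]
  obtain ⟨U, hU⟩ : ∃ U, U = W * W'.map φ := ⟨_, rfl⟩
  obtain ⟨U', hU'⟩ : ∃ U', U' = W.map φ * W' := ⟨_, rfl⟩
  have hUU : U' * U = 1 := by
    rw [hU, hU', Matrix.mul_assoc, ← Matrix.mul_assoc W', hW'W, Matrix.one_mul, hφW]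
  have hUφ : U.map φ = 1 := by
    rw [hU, Matrix.map_mul, hφφ, hφW]
  have hUψ : U.map ψ = U := by
    rw [hU, Matrix.map_mul, hφψ, hWψ, hWψ']
  have hHU : H * U = U * H.map φ := by
    have h2 : H.map φ * W.map φ = W.map φ * diagonal d := by
      rw [← Matrix.map_mul, hHW, Matrix.map_mul, hdiag]
    have h3 : W'.map φ * H.map φ = diagonal d * W'.map φ := by
      calc W'.map φ * H.map φ = W'.map φ * (H.map φ * W.map φ) * W'.map φ := by
            rw [Matrix.mul_assoc, Matrix.mul_assoc, hφW, Matrix.mul_one]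
        _ = _ := by
            rw [h2, ← Matrix.mul_assoc, hφW', Matrix.one_mul]
    rw [hU, ← Matrix.mul_assoc, hHW, Matrix.mul_assoc, Matrix.mul_assoc, h3]
  have hmap (χ : R →+* R) (A : Matrix (Fin l) (Fin l) R) (v : Fin l → R) :
      χ ∘ (A *ᵥ v) = A.map χ *ᵥ (χ ∘ v) := funext fun r ↦ RingHom.map_mulVec χ A v r
  set w := F *ᵥ (U *ᵥ c) with hw
  have hleft : (1 : R) ∈ Ideal.span (Set.range w) ⊔ Ideal.span {x} := by
    refine mem_sup_span_of_dotProduct_map h.dvd_left (u := u₀) ?_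
    rw [hw, hmap, hmap, hUφ, one_mulVec, hc, hu₀]
  have hright : x ^ k ∈ Ideal.span (Set.range w) ⊔ Ideal.span {y} := by
    obtain ⟨z, hz⟩ : ∃ z, z ⬝ᵥ (H.map φ *ᵥ (ψ ∘ c)) = 1 := by
      have h2 := congrArg ψ hu₀
      rw [RingHom.map_dotProduct, map_one, hmap, hφψ, ← hFH, Matrix.map_mul, ← mulVec_mulVec,
        dotProduct_mulVec] at h2
      exact ⟨_, h2⟩
    refine mem_sup_span_of_dotProduct_map h.dvd_right (u := z ᵥ* U' ᵥ* G.map ψ) ?_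
    rw [hw, hmap, hmap, hUψ, ← dotProduct_mulVec, mulVec_mulVec, hGH, smul_mulVec, mulVec_mulVec,
      hHU, dotProduct_smul, ← dotProduct_mulVec, mulVec_mulVec, ← Matrix.mul_assoc, hUU,
      Matrix.one_mul, hz, smul_eq_mul, mul_one]
  have hprod : x ^ p * y ^ q ∈ Ideal.span (Set.range w) := by
    have h2 : ∃ z, z ⬝ᵥ (U *ᵥ c) = 1 := by
      refine ⟨u₀ ᵥ* F.map φ ᵥ* U', ?_⟩
      rw [← dotProduct_mulVec, mulVec_mulVec, hUU, one_mulVec, ← dotProduct_mulVec, hu₀]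
    obtain ⟨z, hz⟩ := h2
    refine Ideal.mem_of_dvd _ hdet (Ideal.mem_span_range_iff_exists_fun.mpr ⟨z ᵥ* F.adjugate, ?_⟩)
    change (z ᵥ* F.adjugate) ⬝ᵥ w = _
    rw [hw, ← dotProduct_mulVec, mulVec_mulVec, adjugate_mul, smul_mulVec, one_mulVec,
      dotProduct_smul, hz, smul_eq_mul, mul_one]
  have htop : Ideal.span (Set.range w) = ⊤ := by
    by_contra hne
    obtain ⟨M, hM, hle⟩ := Ideal.exists_le_maximal _ hne
    have hxM : x ∉ M := fun hx ↦ by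
      have : Ideal.span (Set.range w) ⊔ Ideal.span {x} ≤ M :=
        sup_le hle ((Ideal.span_singleton_le_iff_mem _).mpr hx)
      exact hM.ne_top ((Ideal.eq_top_iff_one _).mpr (this hleft))
    obtain hp | hq := hM.isPrime.mem_or_mem (hle hprod)
    · exact hxM (hM.isPrime.mem_of_pow_mem _ hp)
    · have hy := hM.isPrime.mem_of_pow_mem _ hq
      have : Ideal.span (Set.range w) ⊔ Ideal.span {y} ≤ M :=
        sup_le hle ((Ideal.span_singleton_le_iff_mem _).mpr hy)
      exact hxM (hM.isPrime.mem_of_pow_mem _ (this hright))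
  obtain ⟨u, hu⟩ := Ideal.mem_span_range_iff_exists_fun.mp ((Ideal.eq_top_iff_one _).mp htop)
  exact ⟨u, U *ᵥ c, hu⟩

end KeyStep

section SmithForm

variable {R : Type*} [CommRing R] {l : ℕ}

theorem minorsIdeal_eq_bot_of_lt {k : ℕ} (h : l < k) (F : Matrix (Fin l) (Fin l) R) :
    minorsIdeal k F = ⊥ := by
  refine le_bot_iff.mp (Ideal.span_le.mpr ?_)
  rintro _ ⟨ρ, γ, hρ, -, rfl⟩
  have := Fintype.card_le_of_injective ρ hρ
  simp only [Fintype.card_fin] at this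
  omega

theorem span_pow_mul_pow_le_left {x : R} (y : R) {a b : ℕ} (h : a ≠ 0) :
    Ideal.span {x ^ a * y ^ b} ≤ Ideal.span {x} :=
  Ideal.span_singleton_le_span_singleton.mpr (dvd_mul_of_dvd_left (dvd_pow_self x h) _)

variable [IsDomain R]

theorem le_and_le_of_pow_mul_pow_dvd {x y : R} (hx : Prime x) (hy : Prime y) (hxy : ¬x ∣ y)
    (hyx : ¬y ∣ x) {m n a b : ℕ} (h : x ^ m * y ^ n ∣ x ^ a * y ^ b) : m ≤ a ∧ n ≤ b := by
  constructor
  · refine (pow_dvd_pow_iff hx.ne_zero hx.not_isUnit).mp (hx.pow_dvd_of_dvd_mul_right m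
      (fun h' ↦ hxy (hx.dvd_of_dvd_pow h')) ((Dvd.intro _ rfl).trans h))
  · refine (pow_dvd_pow_iff hy.ne_zero hy.not_isUnit).mp (hy.pow_dvd_of_dvd_mul_left n
      (fun h' ↦ hyx (hy.dvd_of_dvd_pow h')) ((Dvd.intro_left _ rfl).trans h))

theorem FreeProjectives.exists_dotProduct_mulVec_of_le_span (hR : FreeProjectives R)
    {x y : R} {φ ψ : R →+* R} (h : IsRetractionPair x y φ ψ) (hx0 : x ≠ 0)
    {F : Matrix (Fin l) (Fin l) R} {a b : ℕ → ℕ}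
    (hF : ∀ i ≤ l, minorsIdeal i F = Ideal.span {x ^ a i * y ^ b i})
    (h1 : minorsIdeal 1 F = ⊤) {i : ℕ} (hi : minorsIdeal i F = ⊤)
    (hi' : minorsIdeal (i + 1) F ≤ Ideal.span {x}) :
    ∃ u v : Fin l → R, u ⬝ᵥ F *ᵥ v = 1 := by
  classical
  have hex : ∃ j, minorsIdeal (j + 1) F ≤ Ideal.span {y} :=
    ⟨l, by rw [minorsIdeal_eq_bot_of_lt (Nat.lt_succ_self l)]; exact bot_le⟩
  obtain ⟨j, hj, hmin⟩ : ∃ j, minorsIdeal (j + 1) F ≤ Ideal.span {y} ∧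
      ∀ m < j, ¬minorsIdeal (m + 1) F ≤ Ideal.span {y} :=
    ⟨Nat.find hex, Nat.find_spec hex, fun m hm ↦ Nat.find_min hex hm⟩
  have hdet : F.det ∣ x ^ a l * y ^ b l := by
    have := hF l le_rfl
    rw [minorsIdeal_self] at this
    exact Ideal.span_singleton_le_span_singleton.mp this.ge
  obtain ⟨k, hk⟩ : ∃ k, minorsIdeal j F = Ideal.span {x ^ k} := by
    obtain _ | m := j
    · exact ⟨0, by rw [minorsIdeal_zero, pow_zero, Ideal.span_singleton_one]⟩
    · have hm := hmin m (Nat.lt_succ_self m)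
      have hml : m + 1 ≤ l := by
        by_contra! hlt
        rw [minorsIdeal_eq_bot_of_lt hlt] at hm
        exact hm bot_le
      refine ⟨a (m + 1), ?_⟩
      have hb : b (m + 1) = 0 := by
        by_contra hb
        rw [hF _ hml, mul_comm] at hm
        exact hm (span_pow_mul_pow_le_left _ hb)
      rw [hF _ hml, hb, pow_zero, mul_one]
  exact hR.exists_dotProduct_mulVec_eq_one h hx0 hdet h1 hi hi' hk hj

theorem FreeProjectives.exists_dotProduct_mulVec (hR : FreeProjectives R)
    {x y : R} {φ ψ : R →+* R} (h : IsRetractionPair x y φ ψ) (hx0 : x ≠ 0) (hy0 : y ≠ 0)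
    {F : Matrix (Fin l) (Fin l) R} {a b : ℕ → ℕ}
    (hF : ∀ i ≤ l, minorsIdeal i F = Ideal.span {x ^ a i * y ^ b i})
    (h1 : minorsIdeal 1 F = ⊤) : ∃ u v : Fin l → R, u ⬝ᵥ F *ᵥ v = 1 := by
  classical
  have hex : ∃ i, minorsIdeal (i + 1) F ≠ ⊤ :=
    ⟨l, by rw [minorsIdeal_eq_bot_of_lt (Nat.lt_succ_self l)]; exact bot_ne_top⟩
  obtain ⟨i, hi', hmin⟩ : ∃ i, minorsIdeal (i + 1) F ≠ ⊤ ∧ ∀ m < i, minorsIdeal (m + 1) F = ⊤ :=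
    ⟨Nat.find hex, Nat.find_spec hex, fun m hm ↦ not_not.mp (Nat.find_min hex hm)⟩
  have hi : minorsIdeal i F = ⊤ := by
    obtain _ | m := i
    · exact minorsIdeal_zero F
    · exact hmin m (Nat.lt_succ_self m)
  have hor : minorsIdeal (i + 1) F ≤ Ideal.span {x} ∨ minorsIdeal (i + 1) F ≤ Ideal.span {y} := by
    by_cases hil : i + 1 ≤ l
    · rw [hF _ hil] at hi' ⊢
      by_cases ha : a (i + 1) = 0
      · have hb : b (i + 1) ≠ 0 := fun hb ↦ hi' (by simp [ha, hb])
        right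
        rw [mul_comm]
        exact span_pow_mul_pow_le_left _ hb
      · exact Or.inl (span_pow_mul_pow_le_left _ ha)
    · rw [minorsIdeal_eq_bot_of_lt (not_le.mp hil)]
      exact Or.inl bot_le
  obtain hle | hle := hor
  · exact hR.exists_dotProduct_mulVec_of_le_span h hx0 hF h1 hi hle
  · exact hR.exists_dotProduct_mulVec_of_le_span h.symm hy0 (a := b) (b := a)
      (fun i hi ↦ by rw [hF i hi, mul_comm]) h1 hi hle

theorem FreeProjectives.exists_matEquiv_diagonal (hR : FreeProjectives R)
    (hU : UnimodularCompletion R) {x y : R} {φ ψ : R →+* R} (h : IsRetractionPair x y φ ψ)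
    (hx : Prime x) (hy : Prime y) (hxy : ¬x ∣ y) (hyx : ¬y ∣ x)
    (F : Matrix (Fin l) (Fin l) R) (a b : ℕ → ℕ)
    (hF : ∀ i ≤ l, minorsIdeal i F = Ideal.span {x ^ a i * y ^ b i}) :
    ∃ r s : ℕ → ℕ, (∀ i < l, a (i + 1) = a i + r i ∧ b (i + 1) = b i + s i) ∧
      (∀ i j, i ≤ j → j < l → r i ≤ r j ∧ s i ≤ s j) ∧
      MatEquiv F (diagonal fun i : Fin l ↦ x ^ r i * y ^ s i) := by
  induction l generalizing a b with
  | zero =>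
    refine ⟨0, 0, by simp, by simp, ?_⟩
    rw [Subsingleton.elim F (diagonal _)]
    exact MatEquiv.refl _
  | succ l ih =>
    have hmono {m n k p : ℕ} (hle : Ideal.span {x ^ k * y ^ p} ≤ Ideal.span {x ^ m * y ^ n}) :
        m ≤ k ∧ n ≤ p :=
      le_and_le_of_pow_mul_pow_dvd hx hy hxy hyx (Ideal.span_singleton_le_span_singleton.mp hle)
    have h0 : a 0 = 0 ∧ b 0 = 0 := by
      have h1 := (hF 0 (Nat.zero_le _)).symm.trans (minorsIdeal_zero F)
      have := hmono (m := a 0) (n := b 0) (k := 0) (p := 0) (by rw [h1]; exact le_top)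
      omega
    let d := x ^ a 1 * y ^ b 1
    have hd0 : d ≠ 0 := mul_ne_zero (pow_ne_zero _ hx.ne_zero) (pow_ne_zero _ hy.ne_zero)
    have hdvd (i j) : d ∣ F i j := by
      have := mem_minorsIdeal_one F i j
      rw [hF 1 (Nat.succ_le_succ (Nat.zero_le _))] at this
      exact Ideal.mem_span_singleton.mp this
    choose E hE using hdvd
    have hFE : F = d • of E := by
      ext i j
      exact hE i j
    have hEi (i) (hi : i ≤ l + 1) : ∃ a' b' : ℕ, a i = i * a 1 + a' ∧ b i = i * b 1 + b' ∧
        minorsIdeal i (of E) = Ideal.span {x ^ a' * y ^ b'} := by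
      have h1 := hF i hi
      have hdi : d ^ i = x ^ (i * a 1) * y ^ (i * b 1) := by
        rw [mul_pow, ← pow_mul, ← pow_mul, mul_comm (a 1), mul_comm (b 1)]
      rw [hFE, minorsIdeal_smul] at h1
      have h2 : Ideal.span {x ^ a i * y ^ b i} ≤ Ideal.span {x ^ (i * a 1) * y ^ (i * b 1)} := by
        rw [← h1, ← hdi]
        exact Ideal.mul_le_left (I := Ideal.span {d ^ i}) (J := minorsIdeal i (of E))
      obtain ⟨h3, h4⟩ := hmono h2
      obtain ⟨a', ha'⟩ := Nat.exists_eq_add_of_le h3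
      obtain ⟨b', hb'⟩ := Nat.exists_eq_add_of_le h4
      refine ⟨a', b', ha', hb', ?_⟩
      refine (Ideal.span_singleton_mul_right_inj (pow_ne_zero i hd0)).mp (h1.trans ?_)
      rw [Ideal.span_singleton_mul_span_singleton, hdi, ha', hb', pow_add, pow_add]
      congr 2
      ring
    choose! a' b' ha' hb' hE' using hEi
    have hE1 : minorsIdeal 1 (of E) = ⊤ := by
      have h1 := ha' 1 (Nat.succ_le_succ (Nat.zero_le _))
      have h2 := hb' 1 (Nat.succ_le_succ (Nat.zero_le _))
      have h3 : a' 1 = 0 := by omega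
      have h4 : b' 1 = 0 := by omega
      rw [hE' 1 (Nat.succ_le_succ (Nat.zero_le _)), h3, h4]
      simp
    obtain ⟨u, v, huv⟩ := hR.exists_dotProduct_mulVec h hx.ne_zero hy.ne_zero hE' hE1
    obtain ⟨F', hF'⟩ := hU.exists_matEquiv_oneBlock huv
    obtain ⟨r, s, hrs, hmon, heq⟩ := ih F' (fun i ↦ a' (i + 1)) (fun i ↦ b' (i + 1)) fun i hi ↦ by
      rw [← minorsIdeal_oneBlock, ← hF'.minorsIdeal_eq, hE' _ (Nat.succ_le_succ hi)]
    refine ⟨fun i ↦ Nat.casesOn i (a 1) fun i ↦ a 1 + r i,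
      fun i ↦ Nat.casesOn i (b 1) fun i ↦ b 1 + s i, fun i hi ↦ ?_, fun i j hij hj ↦ ?_, ?_⟩
    · obtain _ | i := i
      · simp [h0]
      · have h1 := hrs i (Nat.lt_of_succ_lt_succ hi)
        have h2 := ha' (i + 1) hi.le
        have h3 := hb' (i + 1) hi.le
        have h4 := ha' (i + 1 + 1) hi
        have h5 := hb' (i + 1 + 1) hi
        simp only at h1 ⊢
        rw [h2, h3, h4, h5, h1.1, h1.2]
        constructor <;> ring
    · obtain _ | j := j
      · obtain rfl := Nat.le_zero.mp hij
        exact ⟨le_rfl, le_rfl⟩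
      · obtain _ | i := i
        · exact ⟨Nat.le_add_right _ _, Nat.le_add_right _ _⟩
        · have := hmon i j (Nat.le_of_succ_le_succ hij) (Nat.lt_of_succ_lt_succ hj)
          exact ⟨Nat.add_le_add_left this.1 _, Nat.add_le_add_left this.2 _⟩
    · have h1 := (hF'.trans heq.oneBlock).smul d
      rw [← hFE, oneBlock_diagonal] at h1
      convert h1 using 1
      ext i j
      rw [Matrix.smul_apply, diagonal_apply, diagonal_apply]
      split_ifs
      · cases i using Fin.cases
        · simp [d]
        · simp only [Fin.val_succ, Fin.cons_succ, smul_eq_mul, d]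
          ring
      · simp

end SmithForm

theorem JEqTop.exists_minorsIdeal_eq {R : Type*} [CommRing R] {l k : ℕ}
    {F : Matrix (Fin l) (Fin l) R} (h : JEqTop k F) :
    ∃ d, IsGcdMinors k F d ∧ minorsIdeal k F = Ideal.span {d} := by
  obtain ⟨d, hd, htop⟩ := h
  refine ⟨d, hd, le_antisymm (Ideal.span_le.mpr fun m hm ↦
    Ideal.mem_span_singleton.mpr (hd.1 m hm)) ?_⟩
  calc Ideal.span {d} = Ideal.span {d} * Ideal.span {b | d * b ∈ minorsSet k F} := by
        rw [htop, Ideal.mul_top]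
    _ ≤ minorsIdeal k F := by
        rw [Ideal.span_mul_span', Set.singleton_mul]
        refine Ideal.span_mono ?_
        rintro _ ⟨b, hb, rfl⟩
        exact hb

section Coordinates

variable {K : Type*} [CommRing K] {n : ℕ}

/-- Setting a variable to zero. -/
noncomputable def killX (K : Type*) [CommRing K] {n : ℕ} (v : Fin n) :
    MvPolynomial (Fin n) K →+* MvPolynomial (Fin n) K :=
  (aeval (Function.update X v 0) : MvPolynomial (Fin n) K →ₐ[K] MvPolynomial (Fin n) K)

@[simp] theorem killX_C (v : Fin n) (c : K) : killX K v (C c) = C c :=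
  aeval_C _ c

theorem killX_X (v i : Fin n) : killX K v (X i) = if i = v then 0 else X i := by
  simp [killX, Function.update_apply]

theorem X_dvd_sub_killX (v : Fin n) (r : MvPolynomial (Fin n) K) : X v ∣ r - killX K v r := by
  induction r using MvPolynomial.induction_on with
  | C c => simp
  | add p q hp hq =>
    rw [map_add, add_sub_add_comm]
    exact dvd_add hp hq
  | mul_X p i hp =>
    have h1 : p * X i - killX K v (p * X i) =
        (p - killX K v p) * X i + killX K v p * (X i - killX K v (X i)) := by
      rw [map_mul]
      ring
    rw [h1]
    refine dvd_add (dvd_mul_of_dvd_left hp _) (dvd_mul_of_dvd_right ?_ _)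
    rw [killX_X]
    split_ifs with h
    · rw [h, sub_zero]
    · rw [sub_self]
      exact dvd_zero _

theorem killX_comm (v w : Fin n) (r : MvPolynomial (Fin n) K) :
    killX K v (killX K w r) = killX K w (killX K v r) := by
  have : (killX K v).comp (killX K w) = (killX K w).comp (killX K v) := by
    refine MvPolynomial.ringHom_ext (by simp) fun i ↦ ?_
    simp only [RingHom.comp_apply, killX_X, apply_ite (killX K v), apply_ite (killX K w), map_zero]
    split_ifs <;> rfl
  exact RingHom.congr_fun this r

theorem killX_killX (v : Fin n) (r : MvPolynomial (Fin n) K) :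
    killX K v (killX K v r) = killX K v r := by
  have : (killX K v).comp (killX K v) = killX K v := by
    refine MvPolynomial.ringHom_ext (by simp) fun i ↦ ?_
    simp only [RingHom.comp_apply, killX_X, apply_ite (killX K v), map_zero]
    split_ifs <;> rfl
  exact RingHom.congr_fun this r

theorem isRetractionPair_killX {v w : Fin n} (h : v ≠ w) :
    IsRetractionPair (X v) (X w) (killX K v) (killX K w) where
  left_idem := killX_killX v
  right_idem := killX_killX w
  comm := killX_comm v w
  left_self := by simp [killX_X]
  right_self := by simp [killX_X]
  left_other := by simp [killX_X, h.symm]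
  right_other := by simp [killX_X, h]
  dvd_left := X_dvd_sub_killX v
  dvd_right := X_dvd_sub_killX w

end Coordinates

/-- Let `F ∈ R^{l×l}` with `det F` associated to `x₁^p x₂^q` (`p, q > 0`)
and `d_i(F)` associated to `x₁^{p_i}x₂^{q_i}`.  If `J_i(F) = R` for `i = 1,…,l`, then `F`
is equivalent to its Smith normal form `diag(x₁^{r_1}x₂^{s_1},…,x₁^{r_l}x₂^{s_l})` with
`r_i = p_i - p_{i-1}`, `s_i = q_i - q_{i-1}` (`p_0 = q_0 = 0`), and moreover
`r_1 ≤ ⋯ ≤ r_l` and `s_1 ≤ ⋯ ≤ s_l`. -/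
theorem statement16 {K : Type*} [Field K] {n l : ℕ}
    (v1 v2 : Fin n) (hv1 : (v1 : ℕ) = 0) (hv2 : (v2 : ℕ) = 1)
    (F : Matrix (Fin l) (Fin l) (MvPolynomial (Fin n) K))
    (p q : ℕ) (hp : 0 < p) (hq : 0 < q)
    (hdet : Associated F.det (X v1 ^ p * X v2 ^ q))
    (pk qk : ℕ → ℕ) (hpk0 : pk 0 = 0) (hqk0 : qk 0 = 0)
    (hd : ∀ i, 1 ≤ i → i ≤ l → ∀ d, IsGcdMinors i F d →
      Associated d (X v1 ^ pk i * X v2 ^ qk i))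
    (hJ : ∀ i, 1 ≤ i → i ≤ l → JEqTop i F) :
    MatEquiv F (Matrix.diagonal (fun i : Fin l =>
      X v1 ^ (pk ((i : ℕ) + 1) - pk (i : ℕ)) * X v2 ^ (qk ((i : ℕ) + 1) - qk (i : ℕ)))) ∧
    (∀ i j, 1 ≤ i → i ≤ j → j ≤ l →
      pk i - pk (i - 1) ≤ pk j - pk (j - 1) ∧ qk i - qk (i - 1) ≤ qk j - qk (j - 1)) := by
  have hne : v1 ≠ v2 := fun h ↦ by
    rw [h, hv2] at hv1
    exact one_ne_zero hv1
  have hF (i) (hi : i ≤ l) : minorsIdeal i F = Ideal.span {X v1 ^ pk i * X v2 ^ qk i} := by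
    obtain _ | i := i
    · rw [minorsIdeal_zero, hpk0, hqk0]
      simp
    · obtain ⟨d, hgcd, hspan⟩ := (hJ (i + 1) (Nat.le_add_left 1 i) hi).exists_minorsIdeal_eq
      rw [hspan, Ideal.span_singleton_eq_span_singleton]
      exact hd _ (Nat.le_add_left 1 i) hi d hgcd
  have hnd {v w : Fin n} (h : v ≠ w) :
      ¬(X v : MvPolynomial (Fin n) K) ∣ X w := fun hdvd ↦ h (X_dvd_X.mp hdvd)
  obtain ⟨r, s, hrs, hmono, heq⟩ :=
    (freeProjectives_mvPolynomial K n).exists_matEquiv_diagonal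
      (unimodularCompletion_mvPolynomial K n) (isRetractionPair_killX hne) X_prime
      X_prime (hnd hne) (hnd hne.symm) F pk qk hF
  refine ⟨?_, fun i j hi hij hj ↦ ?_⟩
  · convert heq using 3 with i
    obtain ⟨h1, h2⟩ := hrs i i.2
    rw [h1, h2, Nat.add_sub_cancel_left, Nat.add_sub_cancel_left]
  · obtain ⟨i, rfl⟩ := Nat.exists_eq_add_of_le' hi
    obtain ⟨j, rfl⟩ := Nat.exists_eq_add_of_le' (hi.trans hij)
    have h1 := hrs i (by omega)
    have h2 := hrs j (by omega)
    have h3 := hmono i j (by omega) (by omega)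
    simp only [Nat.add_sub_cancel]
    omega
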